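/- There exist δ ∈ (0,1) and γ > 0 such that for every ε > 0 there exist an open neighborhood U ⊂ ℝ² of Γ and a smooth function H : U → ℝ such that: (1) there are constants m₂, b₂ with H(p) = m₂ p₁ + b₂ on a neighborhood of Γ₂, and constants m₄, b₄ with H(p) = m₄ p₁ + b₄ on a neighborhood of Γ₄; (2) setting G(p₁,p₂,p₃) = H(p₁, √(p₂²+p₃²)), one has ∫_{B₁} ∇G(∇u₀)·∇ψ dx = 0 for every ψ ∈ C_c^∞(B₁ ∖ {0}); (3) ∂H/∂p₂(x, φ(x)) ≥ 1/2 for all x ∈ [−1+δ, 1−δ], and ∂H/∂p₂ ≥ 0 at every point of Γ₁; (4) if p = (x, φ(x)) with −1+δ ≤ x ≤ 1−δ, then S_H(p,q) ≥ γ|p−q|² for all q ∈ Γ; (5) S_H(p,q) ≥ −ε|p−q|² for all p, q ∈ Γ. -/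

import Mathlib

open Real Set Metric Filter
open scoped RealInnerProductSpace

noncomputable section

/-- `w(x₁,x₂) = (x₂² − x₁²)/√(2(x₁²+x₂²))` (with value `0` at the origin, by `0`-division). -/
def w2 : EuclideanSpace ℝ (Fin 2) → ℝ :=
  fun x => ((x 1) ^ 2 - (x 0) ^ 2) / Real.sqrt (2 * ((x 0) ^ 2 + (x 1) ^ 2))

/-- `Γ = ∇w(S¹)`. -/
def Ga : Set (EuclideanSpace ℝ (Fin 2)) :=
  {p | ∃ x : EuclideanSpace ℝ (Fin 2), ‖x‖ = 1 ∧ gradient w2 x = p}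

/-- `Γ₁ = Γ ∩ {p₂ ≥ |p₁|}`. -/
def Ga1 : Set (EuclideanSpace ℝ (Fin 2)) :=
  Ga ∩ {p | |p 0| ≤ p 1}

/-- `Γ₂ = Γ ∩ {p₁ ≤ −|p₂|}`. -/
def Ga2 : Set (EuclideanSpace ℝ (Fin 2)) :=
  Ga ∩ {p | p 0 ≤ -|p 1|}

/-- `Γ₄ = Γ ∩ {p₁ ≥ |p₂|}`. -/
def Ga4 : Set (EuclideanSpace ℝ (Fin 2)) :=
  Ga ∩ {p | |p 1| ≤ p 0}

/-- A point of the plane, as an element of `EuclideanSpace ℝ (Fin 2)`. -/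
def pt (a b : ℝ) : EuclideanSpace ℝ (Fin 2) :=
  (WithLp.equiv 2 (Fin 2 → ℝ)).symm ![a, b]

/-- `u₀(x) = (x₂² + x₃² − x₁²)/(√2·|x|)` (with value `0` at the origin, by `0`-division). -/
def u0 : EuclideanSpace ℝ (Fin 3) → ℝ :=
  fun x => ((x 1) ^ 2 + (x 2) ^ 2 - (x 0) ^ 2) / (Real.sqrt 2 * ‖x‖)

open Metric MeasureTheory


/-! ### Elementary calculus helpers -/

lemma aux_anti {f f' : ℝ → ℝ} {a b : ℝ} (hd : ∀ x ∈ Icc a b, HasDerivAt f (f' x) x)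
    (hn : ∀ x ∈ Icc a b, f' x ≤ 0) : AntitoneOn f (Icc a b) := by
  apply antitoneOn_of_deriv_nonpos (convex_Icc a b)
  · intro x hx; exact (hd x hx).continuousAt.continuousWithinAt
  · intro x hx; exact (hd x (interior_subset hx)).differentiableAt.differentiableWithinAt
  · intro x hx; rw [(hd x (interior_subset hx)).deriv]; exact hn x (interior_subset hx)

lemma aux_mono {f f' : ℝ → ℝ} {a b : ℝ} (hd : ∀ x ∈ Icc a b, HasDerivAt f (f' x) x)
    (hn : ∀ x ∈ Icc a b, 0 ≤ f' x) : MonotoneOn f (Icc a b) := by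
  apply monotoneOn_of_deriv_nonneg (convex_Icc a b)
  · intro x hx; exact (hd x hx).continuousAt.continuousWithinAt
  · intro x hx; exact (hd x (interior_subset hx)).differentiableAt.differentiableWithinAt
  · intro x hx; rw [(hd x (interior_subset hx)).deriv]; exact hn x (interior_subset hx)

/-- Increase–then–decrease principle. -/
lemma aux_bump {F J X' j : ℝ → ℝ} {m n₁ : ℝ} (hm : m ≤ n₁) (hn1 : n₁ ≤ 1)
    (hF : ∀ n ∈ Icc m 1, HasDerivAt F (X' n * J n) n)
    (hX : ∀ n ∈ Icc m 1, 0 ≤ X' n)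
    (hJ : ∀ n ∈ Icc m 1, HasDerivAt J (j n) n)
    (hJm : J m = 0) (hFm : F m = 0) (hF1 : 0 ≤ F 1)
    (hj1 : ∀ n ∈ Icc m n₁, 0 ≤ j n)
    (hj2 : AntitoneOn j (Icc n₁ 1)) :
    ∀ n ∈ Icc m 1, 0 ≤ F n := by
  have hJ1 : ∀ n ∈ Icc m n₁, 0 ≤ J n := by
    intro n hn
    have := aux_mono (f := J) (f' := j) (a := m) (b := n₁)
      (fun x hx => hJ x ⟨hx.1, hx.2.trans hn1⟩) hj1 (left_mem_Icc.2 hm) hn hn.1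
    linarith
  have hF2 : ∀ n ∈ Icc m n₁, 0 ≤ F n := by
    intro n hn
    have := aux_mono (f := F) (f' := fun n => X' n * J n) (a := m) (b := n₁)
      (fun x hx => hF x ⟨hx.1, hx.2.trans hn1⟩)
      (fun x hx => mul_nonneg (hX x ⟨hx.1, hx.2.trans hn1⟩) (hJ1 x hx))
      (left_mem_Icc.2 hm) hn hn.1
    linarith
  -- J is concave on [n₁,1]
  have hconc : ConcaveOn ℝ (Icc n₁ 1) J := by
    apply AntitoneOn.concaveOn_of_deriv (convex_Icc _ _)
    · intro x hx; exact (hJ x ⟨hm.trans hx.1, hx.2⟩).continuousAt.continuousWithinAt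
    · intro x hx
      exact (hJ x ⟨hm.trans (interior_subset hx).1,
        (interior_subset hx).2⟩).differentiableAt.differentiableWithinAt
    · intro x hx y hy hxy
      rw [(hJ x ⟨hm.trans (interior_subset hx).1, (interior_subset hx).2⟩).deriv,
        (hJ y ⟨hm.trans (interior_subset hy).1, (interior_subset hy).2⟩).deriv]
      exact hj2 (interior_subset hx) (interior_subset hy) hxy
  have hJn1 : 0 ≤ J n₁ := hJ1 n₁ ⟨hm, le_rfl⟩
  have key : ∀ s ∈ Icc n₁ 1, 0 ≤ J s → ∀ t ∈ Icc n₁ s, 0 ≤ J t := by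
    intro s hs hJs t ht
    have := hconc.ge_on_segment (x := n₁) (y := s) (z := t) (left_mem_Icc.2 hn1) hs
      (by rw [segment_eq_Icc hs.1]; exact ht)
    exact (le_min hJn1 hJs).trans this
  intro n hn
  rcases le_total n n₁ with h | h
  · exact hF2 n ⟨hn.1, h⟩
  by_cases hJpos : 0 ≤ J n
  · have := aux_mono (f := F) (f' := fun n => X' n * J n) (a := n₁) (b := n)
      (fun x hx => hF x ⟨hm.trans hx.1, hx.2.trans hn.2⟩)
      (fun x hx => mul_nonneg (hX x ⟨hm.trans hx.1, hx.2.trans hn.2⟩)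
        (key n ⟨h, hn.2⟩ hJpos x hx))
      (left_mem_Icc.2 h) (right_mem_Icc.2 h) h
    have h2 := hF2 n₁ ⟨hm, le_rfl⟩
    linarith
  · have := aux_anti (f := F) (f' := fun n => X' n * J n) (a := n) (b := 1)
      (fun x hx => hF x ⟨hn.1.trans hx.1, hx.2⟩)
      (fun x hx => by
        apply mul_nonpos_of_nonneg_of_nonpos (hX x ⟨hn.1.trans hx.1, hx.2⟩)
        by_contra hc
        push Not at hc
        exact hJpos (key x ⟨h.trans hx.1, hx.2⟩ hc.le n ⟨h, hx.1⟩))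
      (left_mem_Icc.2 hn.2) (right_mem_Icc.2 hn.2) hn.2
    linarith

/-! ### The curve -/

def Rr (m : ℝ) : ℝ := √(2 * (1 + m ^ 2))
def Xf (m : ℝ) : ℝ := 2 * m * (3 + m ^ 2) / Rr m ^ 3
def Yf (m : ℝ) : ℝ := 2 * (1 + 3 * m ^ 2) / Rr m ^ 3
def Wf (m : ℝ) : ℝ := (1 - m ^ 2) / Rr m
def dX (m : ℝ) : ℝ := 12 * (1 - m ^ 2) / Rr m ^ 5

lemma Rr_pos (m : ℝ) : 0 < Rr m := Real.sqrt_pos.2 (by positivity)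
lemma Rr_sq (m : ℝ) : Rr m ^ 2 = 2 * (1 + m ^ 2) := Real.sq_sqrt (by positivity)
lemma Rr_neg (m : ℝ) : Rr (-m) = Rr m := by simp [Rr]
lemma Rr_one : Rr 1 = 2 := by
  rw [Rr, show (2:ℝ) * (1 + 1 ^ 2) = 2 ^ 2 by norm_num]; exact Real.sqrt_sq (by norm_num)
lemma Rr_le_two {m : ℝ} (h : m ∈ Icc (-1 : ℝ) 1) : Rr m ≤ 2 := by
  have := Rr_sq m; have := Rr_pos m; nlinarith [h.1, h.2]
lemma Rr_zero : Rr 0 = √2 := by simp [Rr]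
lemma Rr_ge (m : ℝ) : √2 ≤ Rr m := Real.sqrt_le_sqrt (by nlinarith [sq_nonneg m])
lemma Rr_ge' (m : ℝ) : 1.41 ≤ Rr m := by
  have := Rr_sq m; have := Rr_pos m; nlinarith [sq_nonneg m]

lemma Rr_contDiff : ContDiff ℝ (⊤ : ℕ∞) Rr := by
  unfold Rr
  apply ContDiff.sqrt (by fun_prop)
  intro m; positivity

lemma Rr_deriv (m : ℝ) : HasDerivAt Rr (2 * m / Rr m) m := by
  have h : HasDerivAt (fun m : ℝ => 2 * (1 + m ^ 2)) (4 * m) m := by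
    have := ((hasDerivAt_id' m).pow 2).const_add 1 |>.const_mul 2
    exact this.congr_deriv (by simp; ring)
  have := h.sqrt (by positivity)
  refine this.congr_deriv ?_
  have := Rr_pos m
  unfold Rr at *
  field_simp; norm_num; ring

lemma Xf_contDiff : ContDiff ℝ (⊤ : ℕ∞) Xf := by
  unfold Xf
  have := Rr_contDiff
  apply ContDiff.div (by fun_prop) (by fun_prop)
  intro m; have := Rr_pos m; positivity
lemma Wf_contDiff : ContDiff ℝ (⊤ : ℕ∞) Wf := by
  unfold Wf
  have := Rr_contDiff
  apply ContDiff.div (by fun_prop) (by fun_prop)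
  intro m; have := Rr_pos m; positivity

lemma Xf_deriv (m : ℝ) : HasDerivAt Xf (dX m) m := by
  have hp := Rr_pos m
  have hs := Rr_sq m
  have h1 : HasDerivAt (fun m : ℝ => 2 * m * (3 + m ^ 2)) (6 + 6 * m ^ 2) m := by
    have := ((hasDerivAt_id' m).const_mul 2).mul (((hasDerivAt_id' m).pow 2).const_add 3)
    exact this.congr_deriv (by simp; ring)
  have := h1.div ((Rr_deriv m).pow 3) (pow_pos hp 3).ne'
  refine this.congr_deriv ?_
  simp only [dX, Pi.pow_apply]
  generalize Rr m = R at *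
  field_simp
  push_cast
  norm_num
  linear_combination (6 * (1 + m ^ 2) * R ^ 2) * hs

lemma Yf_deriv (m : ℝ) : HasDerivAt Yf (m * dX m) m := by
  have hp := Rr_pos m
  have hs := Rr_sq m
  have h1 : HasDerivAt (fun m : ℝ => 2 * (1 + 3 * m ^ 2)) (12 * m) m := by
    have := ((((hasDerivAt_id' m).pow 2).const_mul 3).const_add 1).const_mul 2
    exact this.congr_deriv (by simp; ring)
  have := h1.div ((Rr_deriv m).pow 3) (pow_pos hp 3).ne'
  refine this.congr_deriv ?_
  simp only [dX, Pi.pow_apply]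
  generalize Rr m = R at *
  field_simp
  push_cast
  norm_num
  linear_combination (12 * m * R ^ 2) * hs

lemma Wf_eq (m : ℝ) : Wf m = Yf m - m * Xf m := by
  have hp := Rr_pos m
  have hs := Rr_sq m
  unfold Wf Yf Xf
  generalize Rr m = R at *
  field_simp
  linear_combination (1 - m ^ 2) * hs

lemma Wf_deriv (m : ℝ) : HasDerivAt Wf (-Xf m) m := by
  have h : Wf = fun m => Yf m - m * Xf m := funext Wf_eq
  rw [h]
  have := (Yf_deriv m).sub ((hasDerivAt_id' m).mul (Xf_deriv m))
  exact this.congr_deriv (by simp)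

lemma dX_nonneg {m : ℝ} (h : m ∈ Icc (-1 : ℝ) 1) : 0 ≤ dX m := by
  have hp := Rr_pos m
  unfold dX
  apply div_nonneg _ (by positivity)
  nlinarith [h.1, h.2]

lemma Xf_neg (m : ℝ) : Xf (-m) = -Xf m := by simp only [Xf, Rr_neg]; ring
lemma Yf_neg (m : ℝ) : Yf (-m) = Yf m := by simp only [Yf, Rr_neg]; ring
lemma Wf_neg (m : ℝ) : Wf (-m) = Wf m := by simp only [Wf, Rr_neg]; ring
lemma Xf_one : Xf 1 = 1 := by simp only [Xf, Rr_one]; norm_num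
lemma Yf_one : Yf 1 = 1 := by simp only [Yf, Rr_one]; norm_num
lemma Wf_one : Wf 1 = 0 := by simp [Wf]
lemma Xf_zero : Xf 0 = 0 := by simp [Xf]

lemma Xf_mono : MonotoneOn Xf (Icc (-1) 1) :=
  aux_mono (fun x _ => Xf_deriv x) (fun _ hx => dX_nonneg hx)

lemma dX_anti {m n : ℝ} (h0 : 0 ≤ m) (h : m ≤ n) (h1 : n ≤ 1) : dX n ≤ dX m := by
  have hp := Rr_pos m
  have hR : Rr m ≤ Rr n := Real.sqrt_le_sqrt (by nlinarith)
  unfold dX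
  have h2 : (0:ℝ) ≤ 12 * (1 - m ^ 2) := by nlinarith
  apply div_le_div₀ h2 (by nlinarith) (by positivity)
  gcongr

lemma dX_le {m : ℝ} (_ : m ∈ Icc (-1 : ℝ) 1) : dX m ≤ 9 / 4 := by
  have hp := Rr_ge' m
  unfold dX
  have h5 : (5.5 : ℝ) ≤ Rr m ^ 5 := by
    calc (5.5 : ℝ) ≤ 1.41 ^ 5 := by norm_num
      _ ≤ _ := by gcongr
  rw [div_le_iff₀ (by linarith)]
  nlinarith [sq_nonneg m]

/-- the gap `1 - m - w(m)` -/
def Gp (m : ℝ) : ℝ := 1 - m - Wf m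

lemma Gp_deriv (m : ℝ) : HasDerivAt Gp (-(1 - Xf m)) m := by
  have := ((hasDerivAt_id' m).const_sub 1).sub (Wf_deriv m)
  exact this.congr_deriv (by ring)

lemma Gp_one : Gp 1 = 0 := by simp [Gp, Wf_one]

lemma Xf_le_one {m : ℝ} (h : m ∈ Icc (-1 : ℝ) 1) : Xf m ≤ 1 := by
  rw [← Xf_one]; exact Xf_mono h (by norm_num) h.2
lemma Xf_ge {m : ℝ} (h : m ∈ Icc (-1 : ℝ) 1) : -1 ≤ Xf m := by
  have := Xf_mono (a := -1) (by norm_num) h h.1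
  rwa [Xf_neg, Xf_one] at this

lemma Gp_nonneg {m : ℝ} (h : m ∈ Icc (-1 : ℝ) 1) : 0 ≤ Gp m := by
  have := aux_anti (fun x _ => Gp_deriv x)
    (fun x hx => by have := Xf_le_one hx; linarith) h (right_mem_Icc.2 (by norm_num)) h.2
  rwa [Gp_one] at this

lemma Gp_le {m : ℝ} (h : m ∈ Icc (-1 : ℝ) 1) : Gp m ≤ 1 - m := by
  have : 0 ≤ Wf m := div_nonneg (by nlinarith [h.1, h.2]) (Rr_pos m).le
  unfold Gp; linarith

lemma key_gap {m : ℝ} (h : m ∈ Icc (0 : ℝ) 1) : 3 * Gp m ≤ (1 - m) * (1 - Xf m) := by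
  have hp := Rr_pos m
  have hs := Rr_sq m
  have hc : Rr m ^ 3 ≤ 3 + 3 * m ^ 2 + 2 * m ^ 3 := by
    have h0 := h.1
    apply le_of_sq_le_sq _ (by positivity)
    have : (Rr m ^ 3) ^ 2 = (2 * (1 + m ^ 2)) ^ 3 := by rw [← hs]; ring
    rw [this]
    have h1 : 0 ≤ 1 - m := by linarith [h.2]
    have : (3 + 3 * m ^ 2 + 2 * m ^ 3) ^ 2 - (2 * (1 + m ^ 2)) ^ 3
      = (1 - m) ^ 3 * (1 + 3 * m + 4 * m ^ 3) := by ring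
    have : 0 ≤ (1 - m) ^ 3 * (1 + 3 * m + 4 * m ^ 3) := by positivity
    linarith
  have h1 : 0 ≤ 1 - m := by linarith [h.2]
  have : (1 - m) * (1 - Xf m) - 3 * Gp m
      = (1 - m) * (2 * (3 + 3 * m ^ 2 + 2 * m ^ 3 - Rr m ^ 3)) / Rr m ^ 3 := by
    unfold Gp Xf Wf
    generalize Rr m = R at *
    field_simp
    linear_combination (3 * (1 - m ^ 2)) * hs
  have : 0 ≤ (1 - m) * (2 * (3 + 3 * m ^ 2 + 2 * m ^ 3 - Rr m ^ 3)) / Rr m ^ 3 := by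
    apply div_nonneg _ (by positivity)
    apply mul_nonneg h1; linarith
  linarith

lemma key_X {m : ℝ} (h : m ∈ Icc (0 : ℝ) 1) : 3 / 8 * (1 - m) ^ 2 ≤ 1 - Xf m := by
  have hp := Rr_pos m
  have hs := Rr_sq m
  have hR := Rr_le_two (m := m) ⟨by linarith [h.1], h.2⟩
  have hk := key_gap h
  rcases eq_or_lt_of_le h.2 with h1 | h1
  · rw [h1, Xf_one]; norm_num
  have h1 : 0 < 1 - m := by linarith
  have hG : Gp m * (Rr m * (Rr m + 1 + m)) = (1 - m) ^ 3 := by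
    unfold Gp Wf
    generalize Rr m = R at *
    field_simp
    linear_combination (1 - m) * hs
  have hB : Rr m * (Rr m + 1 + m) ≤ 8 := by nlinarith [h.1, h.2]
  have hg := Gp_nonneg (m := m) ⟨by linarith [h.1], h.2⟩
  have h8 : (1 - m) ^ 3 ≤ 8 * Gp m := by nlinarith
  have : (1 - m) * (3 / 8 * (1 - m) ^ 2) ≤ (1 - m) * (1 - Xf m) := by nlinarith
  exact le_of_mul_le_mul_left this h1

lemma YX_add (m : ℝ) : Yf m + Xf m = 2 * (1 + m) ^ 3 / Rr m ^ 3 := by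
  unfold Yf Xf; ring
lemma YX_sub (m : ℝ) : Yf m - Xf m = 2 * (1 - m) ^ 3 / Rr m ^ 3 := by
  unfold Yf Xf; ring

lemma absX_le_Y {m : ℝ} (h : m ∈ Icc (-1 : ℝ) 1) : |Xf m| ≤ Yf m := by
  have hp := Rr_pos m
  have h1 : 0 ≤ 1 + m := by linarith [h.1]
  have h2 : 0 ≤ 1 - m := by linarith [h.2]
  have a1 : 0 ≤ 2 * (1 + m) ^ 3 / Rr m ^ 3 := by positivity
  have a2 : 0 ≤ 2 * (1 - m) ^ 3 / Rr m ^ 3 := by positivity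
  rw [← YX_add] at a1; rw [← YX_sub] at a2
  rw [abs_le]; constructor <;> linarith

lemma absX_lt_Y {m : ℝ} (h : m ∈ Ioo (-1 : ℝ) 1) : |Xf m| < Yf m := by
  have hp := Rr_pos m
  have h1 : 0 < 1 + m := by linarith [h.1]
  have h2 : 0 < 1 - m := by linarith [h.2]
  have a1 : 0 < 2 * (1 + m) ^ 3 / Rr m ^ 3 := by positivity
  have a2 : 0 < 2 * (1 - m) ^ 3 / Rr m ^ 3 := by positivity
  rw [← YX_add] at a1; rw [← YX_sub] at a2
  rw [abs_lt]; constructor <;> linarith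

lemma Yf_abs (m : ℝ) : Yf |m| = Yf m := by
  rcases abs_choice m with h | h <;> rw [h]
  exact Yf_neg m

lemma Yf_ge {m : ℝ} (h : m ∈ Icc (-1 : ℝ) 1) : 7 / 10 ≤ Yf m := by
  have hm : |m| ∈ Icc (0:ℝ) 1 := ⟨abs_nonneg m, abs_le.2 h⟩
  have := aux_mono (a := 0) (b := 1) (fun x _ => Yf_deriv x)
    (fun x hx => mul_nonneg hx.1 (dX_nonneg ⟨by linarith [hx.1], hx.2⟩))
    (left_mem_Icc.2 (by norm_num)) hm hm.1
  rw [Yf_abs] at this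
  have h0 : 7 / 10 ≤ Yf 0 := by
    have hp := Rr_pos 0
    have hs := Rr_sq 0
    have : Rr 0 ≤ 10 / 7 := by nlinarith
    unfold Yf
    rw [le_div_iff₀ (by positivity)]
    have : Rr 0 ^ 3 = 2 * Rr 0 := by linear_combination Rr 0 * hs
    rw [this]; linarith
  linarith

lemma Yf_le {m : ℝ} (h : m ∈ Icc (-1 : ℝ) 1) : Yf m ≤ 1 := by
  have hm : |m| ∈ Icc (0:ℝ) 1 := ⟨abs_nonneg m, abs_le.2 h⟩
  have := aux_mono (a := 0) (b := 1) (fun x _ => Yf_deriv x)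
    (fun x hx => mul_nonneg hx.1 (dX_nonneg ⟨by linarith [hx.1], hx.2⟩))
    hm (right_mem_Icc.2 (by norm_num)) hm.2
  rwa [Yf_abs, Yf_one] at this

lemma Xf_third : Xf (1 / 3) ≤ 7 / 10 := by
  have hp := Rr_pos (1 / 3)
  have hs := Rr_sq (1 / 3)
  have : 1.49 ≤ Rr (1 / 3) := by nlinarith
  unfold Xf
  rw [div_le_iff₀ (by positivity)]
  have : Rr (1/3) ^ 3 = 20 / 9 * Rr (1 / 3) := by linear_combination Rr (1/3) * hs
  rw [this]; norm_num; linarith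

lemma Xf_quarter_le : Xf (1 / 4) ≤ 53 / 100 := by
  have hp := Rr_pos (1 / 4)
  have hs := Rr_sq (1 / 4)
  have : 1.45 ≤ Rr (1 / 4) := by nlinarith
  unfold Xf
  rw [div_le_iff₀ (by positivity)]
  have : Rr (1/4) ^ 3 = 17 / 8 * Rr (1 / 4) := by linear_combination Rr (1/4) * hs
  rw [this]; norm_num; linarith

lemma Xf_quarter_ge : 1 / 4 ≤ Xf (1 / 4) := by
  have hp := Rr_pos (1 / 4)
  have hs := Rr_sq (1 / 4)
  have : Rr (1 / 4) ≤ 1.5 := by nlinarith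
  unfold Xf
  rw [le_div_iff₀ (by positivity)]
  have : Rr (1/4) ^ 3 = 17 / 8 * Rr (1 / 4) := by linear_combination Rr (1/4) * hs
  rw [this]; norm_num; linarith

/-- Legendre gap -/
def Dg (m n : ℝ) : ℝ := Yf n - m * Xf n - Wf m

lemma Dg_deriv (m n : ℝ) : HasDerivAt (Dg m) (dX n * (n - m)) n := by
  have := ((Yf_deriv n).sub ((Xf_deriv n).const_mul m)).sub_const (Wf m)
  exact this.congr_deriv (by ring)

lemma Dg_self (m : ℝ) : Dg m m = 0 := by unfold Dg; rw [Wf_eq]; ring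
lemma Dg_one (m : ℝ) : Dg m 1 = Gp m := by unfold Dg Gp; rw [Yf_one, Xf_one]; ring
lemma Dg_neg (m n : ℝ) : Dg (-m) (-n) = Dg m n := by
  unfold Dg; rw [Yf_neg, Xf_neg, Wf_neg]; ring

lemma Dg_ge {m n : ℝ} (hm : m ∈ Icc (-1 : ℝ) 1) (hn : n ∈ Icc (-1 : ℝ) 1) (hmn : m ≤ n) :
    2 / 9 * (Xf n - Xf m) ^ 2 ≤ Dg m n := by
  have hXl : ∀ x ∈ Icc m n, Xf x - Xf m ≤ 9 / 4 * (x - m) := by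
    intro x hx
    have := aux_mono (f := fun x => 9 / 4 * x - Xf x) (f' := fun x => 9 / 4 - dX x)
      (a := m) (b := n)
      (fun x _ => by
        have := ((hasDerivAt_id' x).const_mul (9/4 : ℝ)).sub (Xf_deriv x)
        exact this.congr_deriv (by simp))
      (fun x hx => by have := dX_le ⟨hm.1.trans hx.1, hx.2.trans hn.2⟩; linarith)
      (left_mem_Icc.2 hmn) hx hx.1
    simp only at this
    linarith
  have := aux_mono (f := fun x => Dg m x - 2 / 9 * (Xf x - Xf m) ^ 2)
      (f' := fun x => dX x * ((x - m) - 4 / 9 * (Xf x - Xf m)))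
      (a := m) (b := n)
      (fun x _ => by
        have := (Dg_deriv m x).sub ((((Xf_deriv x).sub_const (Xf m)).pow 2).const_mul (2/9 : ℝ))
        exact this.congr_deriv (by simp; ring))
      (fun x hx => by
        apply mul_nonneg (dX_nonneg ⟨hm.1.trans hx.1, hx.2.trans hn.2⟩)
        have := hXl x hx; linarith)
      (left_mem_Icc.2 hmn) (right_mem_Icc.2 hmn) hmn
  simp only [Dg_self] at this
  nlinarith

/-- `Y` is 1-Lipschitz as function of `X`. -/
lemma Y_lip_aux {m n : ℝ} (hm : m ∈ Icc (-1 : ℝ) 1) (hn : n ∈ Icc (-1 : ℝ) 1) (hmn : m ≤ n) :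
    |Yf n - Yf m| ≤ Xf n - Xf m := by
  have h1 := aux_mono (f := fun x => Xf x + Yf x) (f' := fun x => dX x + x * dX x)
      (a := -1) (b := 1) (fun x _ => (Xf_deriv x).add (Yf_deriv x))
      (fun x hx => by have := dX_nonneg hx; nlinarith [hx.1]) hm hn hmn
  have h2 := aux_mono (f := fun x => Xf x - Yf x) (f' := fun x => dX x - x * dX x)
      (a := -1) (b := 1) (fun x _ => (Xf_deriv x).sub (Yf_deriv x))
      (fun x hx => by have := dX_nonneg hx; nlinarith [hx.2]) hm hn hmn
  simp only at h1 h2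
  rw [abs_le]; constructor <;> linarith

lemma Y_lip {m n : ℝ} (hm : m ∈ Icc (-1 : ℝ) 1) (hn : n ∈ Icc (-1 : ℝ) 1) :
    (Yf n - Yf m) ^ 2 ≤ (Xf n - Xf m) ^ 2 := by
  rw [sq_le_sq]
  rcases le_total m n with h | h
  · exact (Y_lip_aux hm hn h).trans (le_abs_self _)
  · rw [abs_sub_comm, abs_sub_comm (Xf n)]
    exact (Y_lip_aux hn hm h).trans (le_abs_self _)

lemma Xf_surj {a b x : ℝ} (hab : a ≤ b) (hx : x ∈ Icc (Xf a) (Xf b)) : ∃ m ∈ Icc a b, Xf m = x :=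
  intermediate_value_Icc hab Xf_contDiff.continuous.continuousOn hx


/-! ### The cut-off profile -/

def chi (a t : ℝ) : ℝ := smoothTransition ((t - a) / a)
def gf (a z : ℝ) : ℝ := ∫ t in (0:ℝ)..z, 2 * t * chi a t
def Kf (a m : ℝ) : ℝ := gf a (1 - m ^ 2)
def dK (a m : ℝ) : ℝ := -(2 * m) * (2 * (1 - m ^ 2) * chi a (1 - m ^ 2))
def Qf (a m : ℝ) : ℝ := ∫ t in (0:ℝ)..m, 2 * Kf a t
def Ef (a m : ℝ) : ℝ := ∫ t in (0:ℝ)..m, 2 * Xf t * Kf a t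

lemma chi_contDiff (a : ℝ) : ContDiff ℝ (⊤ : ℕ∞) (chi a) := by
  unfold chi
  exact smoothTransition.contDiff.comp (by fun_prop)

lemma chi_nonneg (a t : ℝ) : 0 ≤ chi a t := smoothTransition.nonneg _
lemma chi_le_one (a t : ℝ) : chi a t ≤ 1 := smoothTransition.le_one _
lemma chi_zero {a t : ℝ} (ha : 0 < a) (h : t ≤ a) : chi a t = 0 :=
  smoothTransition.zero_of_nonpos (div_nonpos_of_nonpos_of_nonneg (by linarith) ha.le)
lemma chi_one {a t : ℝ} (ha : 0 < a) (h : 2 * a ≤ t) : chi a t = 1 :=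
  smoothTransition.one_of_one_le (by rw [le_div_iff₀ ha]; linarith)
lemma chi_mono {a s t : ℝ} (ha : 0 < a) (h : s ≤ t) : chi a s ≤ chi a t :=
  smoothTransition.monotone (by gcongr)

lemma aux_int_deriv {f : ℝ → ℝ} (hf : Continuous f) (x : ℝ) :
    HasDerivAt (fun u => ∫ t in (0:ℝ)..u, f t) (f x) x :=
  intervalIntegral.integral_hasDerivAt_right (hf.intervalIntegrable _ _)
    hf.stronglyMeasurable.stronglyMeasurableAtFilter hf.continuousAt

lemma aux_int_contDiff {f : ℝ → ℝ} (hf : ContDiff ℝ (⊤ : ℕ∞) f) :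
    ContDiff ℝ (⊤ : ℕ∞) (fun u => ∫ t in (0:ℝ)..u, f t) := by
  rw [contDiff_infty_iff_deriv]
  refine ⟨fun x => (aux_int_deriv hf.continuous x).differentiableAt, ?_⟩
  have : deriv (fun u => ∫ t in (0:ℝ)..u, f t) = f :=
    funext fun x => (aux_int_deriv hf.continuous x).deriv
  rw [this]; exact hf

lemma gf_contDiff (a : ℝ) : ContDiff ℝ (⊤ : ℕ∞) (gf a) := by
  have := chi_contDiff a
  exact aux_int_contDiff (by fun_prop)
lemma gf_deriv (a z : ℝ) : HasDerivAt (gf a) (2 * z * chi a z) z := by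
  have := (chi_contDiff a).continuous
  exact aux_int_deriv (f := fun t => 2 * t * chi a t) (by fun_prop) z
lemma gf_0 (a : ℝ) : gf a 0 = 0 := by simp [gf]
lemma gf_zero {a z : ℝ} (ha : 0 < a) (h : z ≤ a) : gf a z = 0 := by
  unfold gf
  rw [intervalIntegral.integral_congr (g := fun _ => (0:ℝ))]
  · simp
  · intro t ht
    have : t ≤ a := ht.2.trans (max_le ha.le h)
    simp [chi_zero ha this]
lemma gf_nonneg {a z : ℝ} (ha : 0 < a) : 0 ≤ gf a z := by
  rcases le_total z 0 with h | h
  · rw [gf_zero ha (by linarith)]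
  have := aux_mono (a := 0) (b := z) (fun x _ => gf_deriv a x)
    (fun x hx => mul_nonneg (by linarith [hx.1]) (chi_nonneg a x))
    (left_mem_Icc.2 h) (right_mem_Icc.2 h) h
  rwa [gf_0] at this
lemma gf_le {a z : ℝ} (h : 0 ≤ z) : gf a z ≤ z ^ 2 := by
  have := aux_mono (f := fun x => x ^ 2 - gf a x) (f' := fun x => 2 * x * (1 - chi a x))
    (a := 0) (b := z) (fun x _ => (((hasDerivAt_id' x).pow 2).sub (gf_deriv a x)).congr_deriv
      (by simp; ring))
    (fun x hx => mul_nonneg (by linarith [hx.1]) (by linarith [chi_le_one a x]))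
    (left_mem_Icc.2 h) (right_mem_Icc.2 h) h
  simp only [gf_0] at this
  linarith
lemma gf_ge {a z : ℝ} (ha : 0 < a) (h : 0 ≤ z) : z ^ 2 - 4 * a ^ 2 ≤ gf a z := by
  rcases le_total z (2 * a) with h2 | h2
  · have := gf_nonneg (z := z) ha; nlinarith
  have := aux_anti (f := fun x => x ^ 2 - gf a x) (f' := fun x => 2 * x * (1 - chi a x))
    (a := 2 * a) (b := z) (fun x _ => (((hasDerivAt_id' x).pow 2).sub (gf_deriv a x)).congr_deriv
      (by simp; ring))
    (fun x hx => by rw [chi_one ha hx.1]; simp)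
    (left_mem_Icc.2 h2) (right_mem_Icc.2 h2) h2
  simp only at this
  have := gf_nonneg (z := 2 * a) ha
  linarith
lemma gf_le_chi {a z : ℝ} (ha : 0 < a) (h : 0 ≤ z) : gf a z ≤ z ^ 2 * chi a z := by
  have := aux_anti (f := fun x => gf a x - x ^ 2 * chi a z)
    (f' := fun x => 2 * x * (chi a x - chi a z))
    (a := 0) (b := z)
    (fun x _ => ((gf_deriv a x).sub (((hasDerivAt_id' x).pow 2).mul_const (chi a z))).congr_deriv
      (by simp; ring))
    (fun x hx => mul_nonpos_of_nonneg_of_nonpos (by linarith [hx.1])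
      (by linarith [chi_mono ha hx.2]))
    (left_mem_Icc.2 h) (right_mem_Icc.2 h) h
  simp only [gf_0] at this
  linarith

lemma Kf_contDiff (a : ℝ) : ContDiff ℝ (⊤ : ℕ∞) (Kf a) :=
  (gf_contDiff a).comp (by fun_prop)
lemma Kf_deriv (a m : ℝ) : HasDerivAt (Kf a) (dK a m) m := by
  have h : HasDerivAt (fun m : ℝ => 1 - m ^ 2) (-(2 * m)) m :=
    (((hasDerivAt_id' m).pow 2).const_sub 1).congr_deriv (by simp)
  have := (gf_deriv a (1 - m ^ 2)).comp m h
  exact this.congr_deriv (by unfold dK; ring)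
lemma Kf_neg (a m : ℝ) : Kf a (-m) = Kf a m := by simp [Kf]
lemma Kf_nonneg {a : ℝ} (ha : 0 < a) (m : ℝ) : 0 ≤ Kf a m := gf_nonneg ha
lemma Kf_zero {a m : ℝ} (ha : 0 < a) (h : 1 - m ^ 2 ≤ a) : Kf a m = 0 := gf_zero ha h
lemma Kf_le {a m : ℝ} (h : m ∈ Icc (-1 : ℝ) 1) : Kf a m ≤ (1 - m ^ 2) ^ 2 :=
  gf_le (by nlinarith [h.1, h.2])
lemma Kf_ge {a m : ℝ} (ha : 0 < a) (h : m ∈ Icc (-1 : ℝ) 1) :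
    (1 - m ^ 2) ^ 2 - 4 * a ^ 2 ≤ Kf a m :=
  gf_ge ha (by nlinarith [h.1, h.2])
lemma Kf_one {a : ℝ} (ha : 0 < a) : Kf a 1 = 0 := Kf_zero ha (by norm_num; exact ha.le)
lemma dK_nonpos {a m : ℝ} (h : m ∈ Icc (0 : ℝ) 1) : dK a m ≤ 0 := by
  unfold dK
  have h1 : 0 ≤ 2 * (1 - m ^ 2) * chi a (1 - m ^ 2) :=
    mul_nonneg (by nlinarith [h.1, h.2]) (chi_nonneg _ _)
  nlinarith [h.1]
lemma dK_nonneg {a m : ℝ} (h : m ∈ Icc (-1 : ℝ) 0) : 0 ≤ dK a m := by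
  unfold dK
  have h1 : 0 ≤ 2 * (1 - m ^ 2) * chi a (1 - m ^ 2) :=
    mul_nonneg (by nlinarith [h.1, h.2]) (chi_nonneg _ _)
  nlinarith [h.2]
lemma Kf_anti (a : ℝ) : AntitoneOn (Kf a) (Icc 0 1) :=
  aux_anti (fun x _ => Kf_deriv a x) (fun _ hx => dK_nonpos hx)
lemma Kf_abs (a m : ℝ) : Kf a |m| = Kf a m := by simp [Kf]

lemma Qf_deriv (a m : ℝ) : HasDerivAt (Qf a) (2 * Kf a m) m := by
  have := (Kf_contDiff a).continuous
  exact aux_int_deriv (f := fun t => 2 * Kf a t) (by fun_prop) m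
lemma Qf_contDiff (a : ℝ) : ContDiff ℝ (⊤ : ℕ∞) (Qf a) := by
  have := Kf_contDiff a
  exact aux_int_contDiff (by fun_prop)
lemma Ef_deriv (a m : ℝ) : HasDerivAt (Ef a) (2 * Xf m * Kf a m) m := by
  have := (Kf_contDiff a).continuous
  have := Xf_contDiff.continuous
  exact aux_int_deriv (f := fun t => 2 * Xf t * Kf a t) (by fun_prop) m
lemma Ef_contDiff (a : ℝ) : ContDiff ℝ (⊤ : ℕ∞) (Ef a) := by
  have := Kf_contDiff a
  have := Xf_contDiff
  exact aux_int_contDiff (by fun_prop)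
lemma Qf_neg (a m : ℝ) : Qf a (-m) = -Qf a m := by
  have h := intervalIntegral.integral_comp_neg (a := 0) (b := m) (fun t => 2 * Kf a t)
  simp only [neg_zero, Kf_neg] at h
  unfold Qf
  rw [intervalIntegral.integral_symm, ← h]
lemma Ef_neg (a m : ℝ) : Ef a (-m) = Ef a m := by
  have h := intervalIntegral.integral_comp_neg (a := 0) (b := m) (fun t => 2 * Xf t * Kf a t)
  simp only [neg_zero, Kf_neg, Xf_neg] at h
  unfold Ef
  rw [intervalIntegral.integral_symm, ← h, ← intervalIntegral.integral_neg]
  congr 1; ext t; ring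

lemma Qf_const {a m : ℝ} (ha : 0 < a) (h0 : 0 ≤ m) (h : 1 - m ^ 2 ≤ a) : Qf a m = Qf a 1 := by
  have key : ∀ s t : ℝ, 0 ≤ s → s ≤ t → 1 - s ^ 2 ≤ a → Qf a s = Qf a t := by
    intro s t hs hst h
    apply le_antisymm
    · exact aux_mono (fun x _ => Qf_deriv a x)
        (fun x _ => by have := Kf_nonneg ha x; linarith)
        (left_mem_Icc.2 hst) (right_mem_Icc.2 hst) hst
    · exact aux_anti (fun x _ => Qf_deriv a x)
        (fun x hx => by rw [Kf_zero ha (by nlinarith [hx.1])]; simp)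
        (left_mem_Icc.2 hst) (right_mem_Icc.2 hst) hst
  rcases le_total m 1 with h1 | h1
  · exact key m 1 h0 h1 h
  · exact (key 1 m (by norm_num) h1 (by norm_num; exact ha.le)).symm

lemma Ef_const {a m : ℝ} (ha : 0 < a) (h0 : 0 ≤ m) (h : 1 - m ^ 2 ≤ a) : Ef a m = Ef a 1 := by
  have key : ∀ s t : ℝ, 0 ≤ s → s ≤ t → 1 - s ^ 2 ≤ a → Ef a s = Ef a t := by
    intro s t hs hst h
    apply le_antisymm
    · exact aux_mono (fun x _ => Ef_deriv a x)
        (fun x hx => by rw [Kf_zero ha (by nlinarith [hx.1])]; simp)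
        (left_mem_Icc.2 hst) (right_mem_Icc.2 hst) hst
    · exact aux_anti (fun x _ => Ef_deriv a x)
        (fun x hx => by rw [Kf_zero ha (by nlinarith [hx.1])]; simp)
        (left_mem_Icc.2 hst) (right_mem_Icc.2 hst) hst
  rcases le_total m 1 with h1 | h1
  · exact key m 1 h0 h1 h
  · exact (key 1 m (by norm_num) h1 (by norm_num; exact ha.le)).symm

lemma Qf_mono {a : ℝ} (ha : 0 < a) {s t : ℝ} (h : s ≤ t) : Qf a s ≤ Qf a t :=
  aux_mono (fun x _ => Qf_deriv a x) (fun x _ => by have := Kf_nonneg ha x; linarith)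
        (left_mem_Icc.2 h) (right_mem_Icc.2 h) h
lemma Qf_zero (a : ℝ) : Qf a 0 = 0 := by simp [Qf]
lemma Qf_one_nonneg {a : ℝ} (ha : 0 < a) : 0 ≤ Qf a 1 := by
  rw [← Qf_zero a]; exact Qf_mono ha (by norm_num)

/-! ### The separation function on the curve -/

def Sf (a m n : ℝ) : ℝ := Xf n * (Qf a n - Qf a m) - (Ef a n - Ef a m) - Kf a m * Dg m n

lemma Sf_neg (a m n : ℝ) : Sf a (-m) (-n) = Sf a m n := by
  unfold Sf; rw [Dg_neg, Xf_neg, Qf_neg, Qf_neg, Ef_neg, Ef_neg, Kf_neg]; ring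

lemma Sf_self (a m : ℝ) : Sf a m m = 0 := by unfold Sf; rw [Dg_self]; ring

lemma Sf_deriv (a m n : ℝ) :
    HasDerivAt (Sf a m) (dX n * (Qf a n - Qf a m - (n - m) * Kf a m)) n := by
  have := (((Xf_deriv n).mul ((Qf_deriv a n).sub_const (Qf a m))).sub
    ((Ef_deriv a n).sub_const (Ef a m))).sub ((Dg_deriv m n).const_mul (Kf a m))
  exact this.congr_deriv (by ring)

/-- the general comparison lemma. -/
lemma Sf_compare {a m γ ε : ℝ} (hm : m ∈ Icc (-1 : ℝ) 1) (hε : 0 ≤ ε)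
    (hγ' : γ ≤ Kf a m)
    (h1 : γ * Gp m - ε * (1 - Xf m) ^ 2 ≤ Sf a m 1) :
    ∀ n ∈ Icc m 1, γ * Dg m n - ε * (Xf n - Xf m) ^ 2 ≤ Sf a m n := by
  have hmabs : |m| ≤ 1 := abs_le.2 hm
  have := aux_bump (m := m) (n₁ := |m|)
    (F := fun n => Sf a m n - γ * Dg m n + ε * (Xf n - Xf m) ^ 2)
    (X' := dX)
    (J := fun n => (Qf a n - Qf a m - (n - m) * Kf a m) - γ * (n - m) + 2 * ε * (Xf n - Xf m))
    (j := fun n => 2 * Kf a n - Kf a m - γ + 2 * ε * dX n)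
    (le_abs_self m) hmabs
    (fun n _ => (((Sf_deriv a m n).sub ((Dg_deriv m n).const_mul γ)).add
      ((((Xf_deriv n).sub_const (Xf m)).pow 2).const_mul ε)).congr_deriv (by simp; ring))
    (fun n hn => dX_nonneg ⟨hm.1.trans hn.1, hn.2⟩)
    (fun n _ => (((((Qf_deriv a n).sub_const (Qf a m)).sub
      (((hasDerivAt_id' n).sub_const m).mul_const (Kf a m))).sub
      (((hasDerivAt_id' n).sub_const m).const_mul γ)).add
      (((Xf_deriv n).sub_const (Xf m)).const_mul (2 * ε))).congr_deriv (by simp))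
    (by simp) (by simp [Sf_self, Dg_self])
    (by simp only [Dg_one, Xf_one]; linarith)
    (by
      intro n hn
      have hn' : |n| ≤ |m| := by
        rw [abs_le]
        refine ⟨?_, hn.2⟩
        have := hn.1
        by_cases h : 0 ≤ m
        · have := abs_nonneg m; linarith
        · rw [abs_of_neg (not_le.1 h)]; linarith
      have hK : Kf a m ≤ Kf a n := by
        rw [← Kf_abs a m, ← Kf_abs a n]
        exact Kf_anti a ⟨abs_nonneg _, hn'.trans hmabs⟩ ⟨abs_nonneg _, hmabs⟩ hn'
      have hd : 0 ≤ dX n := dX_nonneg ⟨hm.1.trans hn.1, hn.2.trans hmabs⟩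
      have : 0 ≤ 2 * ε * dX n := by positivity
      linarith)
    (by
      intro x hx y hy hxy
      have h0 : 0 ≤ x := (abs_nonneg m).trans hx.1
      have hK := Kf_anti a ⟨h0, hx.2⟩ ⟨h0.trans hxy, hy.2⟩ hxy
      have hd := dX_anti h0 hxy hy.2
      have : 2 * ε * dX y ≤ 2 * ε * dX x := by gcongr
      simp only
      linarith)
  intro n hn
  have := this n hn
  linarith

lemma S1_deriv (a m : ℝ) :
    HasDerivAt (fun m => Sf a m 1) (-(Kf a m * (1 - Xf m)) - dK a m * Gp m) m := by
  have h : (fun m => Sf a m 1) = fun m => (Qf a 1 - Qf a m) - (Ef a 1 - Ef a m) - Kf a m * Gp m := by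
    ext m; unfold Sf; rw [Dg_one, Xf_one]; ring
  rw [h]
  have := (((Qf_deriv a m).const_sub (Qf a 1)).sub ((Ef_deriv a m).const_sub (Ef a 1))).sub
    ((Kf_deriv a m).mul (Gp_deriv m))
  exact this.congr_deriv (by ring)

lemma S1_ge_KG {a m : ℝ} (ha : 0 < a) (h : m ∈ Icc (-1 : ℝ) 1) : -(Kf a m * Gp m) ≤ Sf a m 1 := by
  have := aux_anti (f := fun m => (Qf a 1 - Qf a m) - (Ef a 1 - Ef a m))
    (f' := fun m => -(2 * Kf a m * (1 - Xf m))) (a := -1) (b := 1)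
    (fun x _ => (((Qf_deriv a x).const_sub (Qf a 1)).sub
      ((Ef_deriv a x).const_sub (Ef a 1))).congr_deriv (by ring))
    (fun x hx => by
      have h1 := Kf_nonneg ha x
      have h2 := Xf_le_one hx
      nlinarith) h (right_mem_Icc.2 (by norm_num)) h.2
  simp only at this
  unfold Sf; rw [Dg_one, Xf_one]; linarith

/-- quantitative decrease of `S(m,1)`. -/
lemma S1_deriv_le {a m : ℝ} (ha : 0 < a) (h : m ∈ Icc (0 : ℝ) 1) (hz : 4 * a ≤ 1 - m ^ 2) :
    -(Kf a m * (1 - Xf m)) - dK a m * Gp m ≤ -(1 / 12 * (1 - m ^ 2) ^ 2 * (1 - Xf m)) := by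
  have h' : m ∈ Icc (-1 : ℝ) 1 := ⟨by linarith [h.1], h.2⟩
  have hK := Kf_ge ha h'
  have hX := Xf_le_one h'
  have hG := Gp_nonneg h'
  have hk := key_gap h
  have hc := chi_le_one a (1 - m ^ 2)
  have hc0 := chi_nonneg a (1 - m ^ 2)
  have hK' : 3 / 4 * (1 - m ^ 2) ^ 2 ≤ Kf a m := by nlinarith
  have h0 := h.1
  have hzpos : 0 ≤ 1 - m ^ 2 := by linarith
  -- 6 m G ≤ (1-X) z
  have h6 : 6 * m * Gp m ≤ (1 - Xf m) * (1 - m ^ 2) := by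
    have e1 : 3 * (1 + m) * Gp m ≤ (1 + m) * ((1 - m) * (1 - Xf m)) := by nlinarith
    have e2 : 6 * m * Gp m ≤ 3 * (1 + m) * Gp m := by
      apply mul_le_mul_of_nonneg_right _ hG; linarith [h.2]
    calc _ ≤ _ := e2
      _ ≤ _ := e1
      _ = _ := by ring
  have hd : -dK a m * Gp m ≤ 2 / 3 * (1 - m ^ 2) ^ 2 * (1 - Xf m) := by
    have e1 : -dK a m ≤ 4 * m * (1 - m ^ 2) := by
      unfold dK
      have : 0 ≤ 4 * m * (1 - m ^ 2) := by positivity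
      nlinarith
    calc -dK a m * Gp m ≤ 4 * m * (1 - m ^ 2) * Gp m := mul_le_mul_of_nonneg_right e1 hG
      _ = 2 / 3 * (1 - m ^ 2) * (6 * m * Gp m) := by ring
      _ ≤ 2 / 3 * (1 - m ^ 2) * ((1 - Xf m) * (1 - m ^ 2)) := by gcongr
      _ = _ := by ring
  have hKX : 3 / 4 * (1 - m ^ 2) ^ 2 * (1 - Xf m) ≤ Kf a m * (1 - Xf m) :=
    mul_le_mul_of_nonneg_right hK' (by linarith)
  nlinarith

/-- the threshold slope -/
def mth (a : ℝ) : ℝ := √(1 - 4 * a)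

lemma mth_sq {a : ℝ} (ha : a ≤ 1 / 200) : mth a ^ 2 = 1 - 4 * a := Real.sq_sqrt (by linarith)
lemma mth_nonneg (a : ℝ) : 0 ≤ mth a := Real.sqrt_nonneg _
lemma mth_le {a : ℝ} (h0 : 0 < a) (ha : a ≤ 1 / 200) : mth a ≤ 1 := by
  have := mth_sq ha; have := mth_nonneg a; nlinarith
lemma mth_ge {a : ℝ} (ha : a ≤ 1 / 200) : 1 / 2 ≤ mth a := by
  have := mth_sq ha; have := mth_nonneg a; nlinarith
lemma mth_ge' {a : ℝ} (h0 : 0 < a) (ha : a ≤ 1 / 200) : 1 - mth a ≤ 4 * a := by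
  have := mth_sq ha; have := mth_nonneg a; have := mth_le h0 ha; nlinarith

lemma S1_anti {a : ℝ} (h0 : 0 < a) (ha : a ≤ 1 / 200) :
    AntitoneOn (fun m => Sf a m 1) (Icc (-1) (mth a)) := by
  apply aux_anti (fun x _ => S1_deriv a x)
  intro m hm
  have h1 := mth_le h0 ha
  have h' : m ∈ Icc (-1 : ℝ) 1 := ⟨hm.1, hm.2.trans h1⟩
  have hX := Xf_le_one h'
  rcases le_total m 0 with h | h
  · have := dK_nonneg (a := a) ⟨hm.1, h⟩
    have := Gp_nonneg h'
    have := Kf_nonneg h0 m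
    have : 0 ≤ Kf a m * (1 - Xf m) := mul_nonneg this (by linarith)
    have : 0 ≤ dK a m * Gp m := by positivity
    linarith
  · have hs := mth_sq ha
    have := S1_deriv_le h0 ⟨h, h'.2⟩ (by nlinarith [hm.2])
    have : 0 ≤ (1 / 12 * (1 - m ^ 2) ^ 2 * (1 - Xf m)) := mul_nonneg (by positivity) (by linarith)
    linarith

/-- almost-nonnegativity towards the cusp -/
lemma S1_ge {a ε : ℝ} (h0 : 0 < a) (ha : a ≤ 1 / 200) (hε : 16 * a ≤ ε) {m : ℝ}
    (hm : m ∈ Icc (-1 : ℝ) 1) : -ε * (1 - Xf m) ^ 2 ≤ Sf a m 1 := by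
  have near : ∀ m ∈ Icc (mth a) 1, -ε * (1 - Xf m) ^ 2 ≤ Sf a m 1 := by
    intro m hm
    have hm0 : 0 ≤ m := (mth_nonneg a).trans hm.1
    have h' : m ∈ Icc (-1 : ℝ) 1 := ⟨by linarith, hm.2⟩
    have h1 := S1_ge_KG h0 h'
    have h2 := Kf_le (a := a) h'
    have h3 := Gp_nonneg h'
    have h4 := key_gap ⟨hm0, hm.2⟩
    have h5 := key_X ⟨hm0, hm.2⟩
    have h6 : 1 - m ≤ 4 * a := by have := mth_ge' h0 ha; linarith [hm.1]
    have h7 := Kf_nonneg h0 m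
    set t := 1 - m with ht
    have ht0 : 0 ≤ t := by linarith [hm.2]
    set X := 1 - Xf m with hX
    have hX0 : 0 ≤ X := le_trans (by positivity) h5
    have e1 : Kf a m ≤ 4 * t ^ 2 := by
      refine h2.trans ?_
      have : (1 - m ^ 2) ^ 2 = t ^ 2 * (1 + m) ^ 2 := by rw [ht]; ring
      rw [this]
      have : (1 + m) ^ 2 ≤ 4 := by nlinarith [hm.2]
      nlinarith [sq_nonneg t]
    have e2 : Kf a m * Gp m ≤ 4 * t ^ 2 * (t * X / 3) := by
      apply mul_le_mul e1 (by linarith) h3 (by positivity)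
    have e3 : 4 * t ^ 2 * (t * X / 3) ≤ ε * X ^ 2 := by
      have : 4 / 3 * t * t ^ 2 ≤ ε * X := by
        calc 4 / 3 * t * t ^ 2 ≤ 4 / 3 * (4 * a) * t ^ 2 := by gcongr
          _ = 16 * a / 3 * t ^ 2 := by ring
          _ ≤ ε / 3 * t ^ 2 := by gcongr
          _ = ε * (1 / 3 * t ^ 2) := by ring
          _ ≤ ε * X := by
            apply mul_le_mul_of_nonneg_left _ (by linarith)
            nlinarith [sq_nonneg t]
      calc _ = (4 / 3 * t * t ^ 2) * X := by ring
        _ ≤ (ε * X) * X := by gcongr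
        _ = _ := by ring
    linarith
  rcases le_total (mth a) m with h | h
  · exact near m ⟨h, hm.2⟩
  have h1 := mth_le h0 ha
  have h2 := S1_anti h0 ha ⟨hm.1, h⟩ ⟨hm.1.trans h, le_rfl⟩ h
  have h3 := near (mth a) ⟨le_rfl, h1⟩
  have h4 := Xf_mono hm ⟨by linarith [mth_nonneg a], h1⟩ h
  have h5 := Xf_le_one (m := mth a) ⟨by linarith [mth_nonneg a], h1⟩
  simp only at h2
  have : ε * (1 - Xf (mth a)) ^ 2 ≤ ε * (1 - Xf m) ^ 2 := by
    apply mul_le_mul_of_nonneg_left _ (by linarith)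
    apply pow_le_pow_left₀ (by linarith); linarith
  linarith

lemma S1_quarter {a : ℝ} (h0 : 0 < a) (ha : a ≤ 1 / 200) {m : ℝ} (hm : m ∈ Icc (-1 : ℝ) (1 / 4)) :
    1 / 1000 ≤ Sf a m 1 := by
  have hmt := mth_ge ha
  have hmt1 := mth_le h0 ha
  have h1 := S1_anti h0 ha ⟨hm.1, by linarith [hm.2]⟩ ⟨by norm_num, by linarith⟩ hm.2
  have h2 := S1_anti h0 ha (show (1 / 2 : ℝ) ∈ Icc (-1) (mth a) from ⟨by norm_num, hmt⟩) ⟨by linarith, le_rfl⟩ hmt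
  have hmm : mth a ∈ Icc (-1 : ℝ) 1 := ⟨by linarith, hmt1⟩
  have h3 := S1_ge_KG h0 hmm
  have h4 := Kf_le (a := a) hmm
  have h5 := Gp_nonneg hmm
  have h6 := Gp_le hmm
  have h7 := mth_ge' h0 ha
  rw [mth_sq ha] at h4
  have h8 : Kf a (mth a) * Gp (mth a) ≤ (1 / 50) ^ 2 * (1 / 50) := by
    apply mul_le_mul _ (by linarith) h5 (by positivity)
    refine h4.trans ?_
    apply pow_le_pow_left₀ (by linarith); linarith
  have h9 := aux_anti (f := fun m => Sf a m 1 + 43 / 10000 * m)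
    (f' := fun m => (-(Kf a m * (1 - Xf m)) - dK a m * Gp m) + 43 / 10000) (a := 1 / 4) (b := 1 / 2)
    (fun x _ => ((S1_deriv a x).add ((hasDerivAt_id' x).const_mul (43 / 10000 : ℝ))).congr_deriv
      (by simp))
    (fun x hx => by
      have hx' : x ∈ Icc (0:ℝ) 1 := ⟨by linarith [hx.1], by linarith [hx.2]⟩
      have hz : 3 / 4 ≤ 1 - x ^ 2 := by nlinarith [hx.1, hx.2]
      have := S1_deriv_le h0 hx' (by linarith)
      have hX := key_X hx'
      have : 3 / 32 ≤ 1 - Xf x := by nlinarith [hx.1, hx.2]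
      have : 1 / 12 * (3 / 4) ^ 2 * (3 / 32) ≤ 1 / 12 * (1 - x ^ 2) ^ 2 * (1 - Xf x) := by
        gcongr
      norm_num at this
      linarith)
    (left_mem_Icc.2 (by norm_num)) (right_mem_Icc.2 (by norm_num)) (by norm_num)
  simp only at h1 h2 h9
  norm_num at h8 h9
  linarith


/-! ### Remaining scalar inequalities -/

lemma Sf_ge {a ε : ℝ} (h0 : 0 < a) (ha : a ≤ 1 / 200) (hε : 16 * a ≤ ε) {m n : ℝ}
    (hm : m ∈ Icc (-1 : ℝ) 1) (hn : n ∈ Icc (-1 : ℝ) 1) :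
    -ε * (Xf n - Xf m) ^ 2 ≤ Sf a m n := by
  have main : ∀ m n : ℝ, m ∈ Icc (-1 : ℝ) 1 → n ∈ Icc (-1 : ℝ) 1 → m ≤ n →
      -ε * (Xf n - Xf m) ^ 2 ≤ Sf a m n := by
    intro m n hm hn hmn
    have := Sf_compare (a := a) (m := m) (γ := 0) (ε := ε) hm (by linarith) (Kf_nonneg h0 m)
      (by have := S1_ge h0 ha hε hm; linarith) n ⟨hmn, hn.2⟩
    linarith
  rcases le_total m n with h | h
  · exact main m n hm hn h
  · have := main (-m) (-n) ⟨by linarith [hm.2], by linarith [hm.1]⟩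
      ⟨by linarith [hn.2], by linarith [hn.1]⟩ (by linarith)
    rw [Sf_neg, Xf_neg, Xf_neg] at this
    refine le_trans (le_of_eq ?_) this
    ring

lemma Kf_half {a : ℝ} (h0 : 0 < a) (ha : a ≤ 1 / 200) {m : ℝ} (hm : |m| ≤ 1 / 4) :
    1 / 2 ≤ Kf a m := by
  have hm' := abs_le.1 hm
  have := Kf_ge h0 (m := m) ⟨by linarith [hm'.1], by linarith [hm'.2]⟩
  have h2 : m ^ 2 ≤ 1 / 16 := by nlinarith [hm'.1, hm'.2]
  have h3 : (15 / 16) ^ 2 ≤ (1 - m ^ 2) ^ 2 := by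
    apply pow_le_pow_left₀ (by norm_num); linarith
  nlinarith

lemma Sf_mid {a : ℝ} (h0 : 0 < a) (ha : a ≤ 1 / 200) {m n : ℝ}
    (hm : |m| ≤ 1 / 4) (hn : n ∈ Icc (-1 : ℝ) 1) :
    1 / 9000 * (Xf n - Xf m) ^ 2 ≤ Sf a m n := by
  have main : ∀ m n : ℝ, |m| ≤ 1 / 4 → n ∈ Icc (-1 : ℝ) 1 → m ≤ n →
      1 / 9000 * (Xf n - Xf m) ^ 2 ≤ Sf a m n := by
    intro m n hm hn hmn
    have hm' := abs_le.1 hm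
    have hmI : m ∈ Icc (-1 : ℝ) 1 := ⟨by linarith [hm'.1], by linarith [hm'.2]⟩
    have hK := Kf_half h0 ha hm
    have hG := Gp_le hmI
    have := Sf_compare (a := a) (m := m) (γ := 1 / 2000) (ε := 0) hmI le_rfl (by linarith)
      (by
        have := S1_quarter h0 ha (m := m) ⟨hmI.1, hm'.2⟩
        linarith [hm'.1]) n ⟨hmn, hn.2⟩
    have := Dg_ge hmI hn hmn
    linarith
  rcases le_total m n with h | h
  · exact main m n hm hn h
  · have := main (-m) (-n) (by rwa [abs_neg])
      ⟨by linarith [hn.2], by linarith [hn.1]⟩ (by linarith)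
    rw [Sf_neg, Xf_neg, Xf_neg] at this
    refine le_trans (le_of_eq ?_) this
    ring

def Nf (a m : ℝ) : ℝ := Qf a 1 - Qf a m - (1 - m) * Kf a m

lemma Nf_deriv (a m : ℝ) : HasDerivAt (Nf a) (-Kf a m - (1 - m) * dK a m) m := by
  have := ((Qf_deriv a m).const_sub (Qf a 1)).sub
    (((hasDerivAt_id' m).const_sub 1).mul (Kf_deriv a m))
  exact this.congr_deriv (by ring)

lemma Nf_nonpos {a m : ℝ} (h0 : 0 < a) (hm : m ∈ Icc (1 / 3 : ℝ) 1) : Nf a m ≤ 0 := by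
  have := aux_mono (a := 1 / 3) (b := 1) (fun x _ => Nf_deriv a x) (by
    intro x hx
    have hz : 0 ≤ 1 - x ^ 2 := by nlinarith [hx.1, hx.2]
    have h1 := gf_le_chi h0 hz
    have hc := chi_nonneg a (1 - x ^ 2)
    have h2 : (1 - x ^ 2) ^ 2 * chi a (1 - x ^ 2) ≤
        4 * x * (1 - x) * (1 - x ^ 2) * chi a (1 - x ^ 2) := by
      gcongr ?_ * _
      have : 0 ≤ (1 - x) * (3 * x - 1) := mul_nonneg (by linarith [hx.2]) (by linarith [hx.1])
      nlinarith
    unfold Kf dK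
    nlinarith) hm (right_mem_Icc.2 (by norm_num)) hm.2
  refine this.trans ?_
  simp [Nf]

def Rf (a n : ℝ) : ℝ := Ef a 1 - Ef a n - Xf n * (Qf a 1 - Qf a n)

lemma Rf_deriv (a n : ℝ) : HasDerivAt (Rf a) (-(dX n * (Qf a 1 - Qf a n))) n := by
  have := ((Ef_deriv a n).const_sub (Ef a 1)).sub
    ((Xf_deriv n).mul ((Qf_deriv a n).const_sub (Qf a 1)))
  exact this.congr_deriv (by ring)

lemma Rf_one (a : ℝ) : Rf a 1 = 0 := by simp [Rf]

lemma Rf_nonneg {a n : ℝ} (h0 : 0 < a) (hn : n ∈ Icc (-1 : ℝ) 1) : 0 ≤ Rf a n := by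
  have := aux_anti (a := -1) (b := 1) (fun x _ => Rf_deriv a x) (by
    intro x hx
    have := dX_nonneg hx
    have := Qf_mono h0 hx.2
    have : 0 ≤ dX x * (Qf a 1 - Qf a x) := mul_nonneg (by assumption) (by linarith)
    linarith) hn (right_mem_Icc.2 (by norm_num)) hn.2
  rwa [Rf_one] at this

lemma Rf_le {a n : ℝ} (h0 : 0 < a) (hn : n ∈ Icc (1 / 3 : ℝ) 1) :
    Rf a n ≤ Kf a n * (Yf n - Xf n) := by
  have := aux_anti (a := 1 / 3) (b := 1) (f := fun n => Kf a n * (Yf n - Xf n) - Rf a n)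
    (fun x _ => ((Kf_deriv a x).mul ((Yf_deriv x).sub (Xf_deriv x))).sub (Rf_deriv a x)) (by
    intro x hx
    have hx' : x ∈ Icc (-1 : ℝ) 1 := ⟨by linarith [hx.1], hx.2⟩
    have h1 := dX_nonneg hx'
    have h2 := Nf_nonpos h0 hx
    have h3 := dK_nonpos (a := a) (m := x) ⟨by linarith [hx.1], hx.2⟩
    have h4 : 0 ≤ Yf x - Xf x := by
      have := absX_le_Y hx'; have := le_abs_self (Xf x); linarith
    have h5 := mul_nonpos_of_nonpos_of_nonneg h3 h4
    have h6 := mul_nonpos_of_nonneg_of_nonpos h1 h2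
    simp only [Nf, Pi.sub_apply] at h6 ⊢
    nlinarith) hn (right_mem_Icc.2 (by norm_num)) hn.2
  simp only [Rf_one, Yf_one, Xf_one] at this
  linarith

def S4 (a m q0 q1 : ℝ) : ℝ :=
  Qf a 1 * q0 - Ef a 1 - (q0 * (Qf a m - m * Kf a m) + (q1 - Wf m) * Kf a m - Ef a m)

lemma S4_ge {a m q0 q1 : ℝ} (h0 : 0 < a) (hq : q1 ≤ q0) :
    Sf a m 1 - (1 - q0) * Nf a m ≤ S4 a m q0 q1 := by
  have h := Kf_nonneg h0 m
  have : 0 ≤ Kf a m * (q0 - q1) := mul_nonneg h (by linarith)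
  have e : S4 a m q0 q1 = Sf a m 1 - (1 - q0) * Nf a m + Kf a m * (q0 - q1) := by
    unfold S4 Sf Nf; rw [Dg_one, Xf_one]; unfold Gp; ring
  linarith

lemma S4_eq (a m n q1 : ℝ) :
    S4 a m (Xf n) q1 = Sf a m n + Kf a m * (Yf n - q1) - Rf a n := by
  unfold S4 Sf Rf Dg; ring

lemma S4_eq' (a m n : ℝ) :
    Sf a m 1 - (1 - Xf n) * Nf a m = Sf a m n + Kf a m * (Yf n - Xf n) - Rf a n := by
  unfold Sf Nf Rf; rw [Dg_one, Xf_one]; unfold Gp Dg; ring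

lemma Wf_zero_le_Y {n : ℝ} (hn : n ∈ Icc (-1 : ℝ) 1) : Wf 0 ≤ Yf n := by
  have hm : |n| ∈ Icc (0:ℝ) 1 := ⟨abs_nonneg n, abs_le.2 hn⟩
  have := Dg_ge (m := 0) (n := |n|) (by norm_num) ⟨by linarith [hm.1], hm.2⟩ hm.1
  unfold Dg at this
  rw [Yf_abs] at this
  nlinarith [sq_nonneg (Xf |n| - Xf 0)]

lemma Wf_le {m : ℝ} (hm : m ∈ Icc (-1 : ℝ) 0) : Wf m ≤ Wf 0 := by
  have := Dg_ge (m := m) (n := 0) ⟨hm.1, by linarith [hm.2]⟩ (by norm_num) hm.2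
  have h2 := Wf_eq 0
  unfold Dg at this
  rw [Xf_zero] at this h2
  nlinarith [sq_nonneg (0 - Xf m)]

lemma q0_rep {q0 : ℝ} (hq : Wf 0 ≤ q0) (hq1 : q0 ≤ 1) : ∃ n ∈ Icc (1 / 3 : ℝ) 1, Xf n = q0 := by
  apply Xf_surj (by norm_num)
  rw [Xf_one]
  have h1 := Yf_ge (m := 0) (by norm_num)
  have h2 := Wf_eq 0
  have := Xf_third
  exact ⟨by linarith, hq1⟩

/-- `Γ₁`–`Γ₄` separation at all points. -/
lemma S4_main {a ε : ℝ} (h0 : 0 < a) (ha : a ≤ 1 / 200) (hε : 16 * a ≤ ε) {m q0 q1 : ℝ}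
    (hm : m ∈ Icc (-1 : ℝ) 1) (hq : q1 ≤ q0) (hq0 : Wf 0 ≤ q0) (hq1 : q0 ≤ 1) :
    -ε * (q0 - Xf m) ^ 2 ≤ S4 a m q0 q1 := by
  obtain ⟨n, hn, rfl⟩ := q0_rep hq0 hq1
  have hn' : n ∈ Icc (-1 : ℝ) 1 := ⟨by linarith [hn.1], hn.2⟩
  have hYX : 0 ≤ Yf n - Xf n := by
    have := absX_le_Y hn'; have := le_abs_self (Xf n); linarith
  have hR := Rf_le h0 hn
  have hge := S4_ge (m := m) h0 hq
  have hsq : 0 ≤ ε * (Xf n - Xf m) ^ 2 := mul_nonneg (by linarith) (sq_nonneg _)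
  have hcomp : ∀ m : ℝ, 0 ≤ m → m ≤ n → -ε * (Xf n - Xf m) ^ 2 ≤
      Sf a m 1 - (1 - Xf n) * Nf a m := by
    intro m hm0 hmn
    rw [S4_eq']
    have h1 := Sf_ge h0 ha hε (m := m) ⟨by linarith, by linarith [hn.2]⟩ hn'
    have h2 := Kf_anti a ⟨hm0, by linarith [hn.2]⟩ ⟨by linarith [hn.1], hn.2⟩ hmn
    have h3 := mul_le_mul_of_nonneg_right h2 hYX
    linarith
  rcases le_total m 0 with hm0 | hm0
  · have h1 := aux_anti (a := -1) (b := 0) (f := fun m => Sf a m 1 - (1 - Xf n) * Nf a m)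
      (fun x _ => (S1_deriv a x).sub ((Nf_deriv a x).const_mul (1 - Xf n))) (by
      intro x hx
      have hK := Kf_nonneg h0 x
      have hd := dK_nonneg (a := a) hx
      have hX : Xf x ≤ 0 := by
        rw [← Xf_zero]; exact Xf_mono ⟨hx.1, by linarith [hx.2]⟩ (by norm_num) hx.2
      have hW := Wf_le hx
      have hY := Yf_ge (m := 0) (by norm_num)
      have h2 := Wf_eq 0
      have hp : 0 ≤ Xf n := by linarith
      have e1 : 0 ≤ Kf a x * (Xf n - Xf x) := mul_nonneg hK (by linarith)
      have e2 : 0 ≤ dK a x * ((1 - x) * Xf n - Wf x) := by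
        apply mul_nonneg hd
        nlinarith [hx.2]
      unfold Gp
      nlinarith) ⟨hm.1, hm0⟩ (right_mem_Icc.2 (by norm_num)) hm0
    simp only at h1
    rw [S4_eq'] at h1
    have h2 : 0 ≤ Sf a 0 n := by
      have := Sf_mid h0 ha (m := 0) (by norm_num) hn'
      nlinarith [sq_nonneg (Xf n - Xf 0)]
    have h3 := Kf_anti a (left_mem_Icc.2 (by norm_num)) ⟨by linarith [hn.1], hn.2⟩
      (by linarith [hn.1] : (0:ℝ) ≤ n)
    have h4 := mul_le_mul_of_nonneg_right h3 hYX
    linarith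
  rcases le_total m n with hmn | hmn
  · exact (hcomp m hm0 hmn).trans hge
  · have hm3 : m ∈ Icc (1 / 3 : ℝ) 1 := ⟨hn.1.trans hmn, hm.2⟩
    have hN := Nf_nonpos h0 hm3
    have hRm := Rf_le h0 hm3
    have hX := Xf_mono hn' hm hmn
    have e := S4_eq' a m m
    rw [Sf_self] at e
    nlinarith

lemma S4_mid {a : ℝ} (h0 : 0 < a) (ha : a ≤ 1 / 200) {m q0 q1 : ℝ}
    (hm : |m| ≤ 1 / 4) (hq : q1 ≤ q0) (hq0 : Wf 0 ≤ q0) (hq1 : q0 ≤ 1) :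
    1 / 400000 ≤ S4 a m q0 q1 := by
  obtain ⟨n, hn, rfl⟩ := q0_rep hq0 hq1
  have hn' : n ∈ Icc (-1 : ℝ) 1 := ⟨by linarith [hn.1], hn.2⟩
  have hm' := abs_le.1 hm
  have hYX : 0 ≤ Yf n - Xf n := by
    have := absX_le_Y hn'; have := le_abs_self (Xf n); linarith
  have hR := Rf_le h0 hn
  have hge := S4_ge (m := m) h0 hq
  rw [S4_eq'] at hge
  have h1 := Sf_mid h0 ha hm hn'
  have h2 := Kf_anti a ⟨abs_nonneg m, by linarith⟩ ⟨by linarith [hn.1], hn.2⟩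
    (by linarith [hn.1] : |m| ≤ n)
  rw [Kf_abs] at h2
  have h3 := mul_le_mul_of_nonneg_right h2 hYX
  have h4 := Xf_mono ⟨by linarith [hm'.1], by linarith [hm'.2]⟩ (by norm_num) hm'.2
  have h5 := Xf_quarter_le
  have h6 := Yf_ge (m := 0) (by norm_num)
  have h7 := Wf_eq 0
  have h8 : (17 / 100) ^ 2 ≤ (Xf n - Xf m) ^ 2 := pow_le_pow_left₀ (by norm_num) (by linarith) 2
  linarith


/-! ### Gradients and the curve -/

lemma pt_zero (a b : ℝ) : pt a b 0 = a := by simp [pt]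
lemma pt_one (a b : ℝ) : pt a b 1 = b := by simp [pt]
lemma pt_ext {p : EuclideanSpace ℝ (Fin 2)} {a b : ℝ} (h0 : p 0 = a) (h1 : p 1 = b) :
    p = pt a b := by
  ext i; fin_cases i
  · simpa [pt_zero] using h0
  · simpa [pt_one] using h1

lemma inner2 (p q : EuclideanSpace ℝ (Fin 2)) : ⟪p, q⟫ = p 0 * q 0 + p 1 * q 1 := by
  rw [PiLp.inner_apply, Fin.sum_univ_two]; simp [mul_comm]
lemma norm2 (p : EuclideanSpace ℝ (Fin 2)) : ‖p‖ ^ 2 = p 0 ^ 2 + p 1 ^ 2 := by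
  rw [EuclideanSpace.norm_sq_eq, Fin.sum_univ_two]; simp

lemma proj2 (i : Fin 2) (x : EuclideanSpace ℝ (Fin 2)) :
    HasFDerivAt (fun p : EuclideanSpace ℝ (Fin 2) => p i)
      (EuclideanSpace.proj (𝕜 := ℝ) i : EuclideanSpace ℝ (Fin 2) →L[ℝ] ℝ) x :=
  (EuclideanSpace.proj (𝕜 := ℝ) i : EuclideanSpace ℝ (Fin 2) →L[ℝ] ℝ).hasFDerivAt

lemma grad2 {f : EuclideanSpace ℝ (Fin 2) → ℝ} {x : EuclideanSpace ℝ (Fin 2)}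
    {L : EuclideanSpace ℝ (Fin 2) →L[ℝ] ℝ} {a b : ℝ}
    (h : HasFDerivAt f L x) (hL : ∀ v : EuclideanSpace ℝ (Fin 2), L v = a * v 0 + b * v 1) :
    HasGradientAt f (pt a b) x := by
  rw [hasGradientAt_iff_hasFDerivAt]
  refine h.congr_fderiv ?_
  ext v
  rw [hL, InnerProductSpace.toDual_apply_apply, inner2, pt_zero, pt_one]

lemma sq_scale {t r m : ℝ} (ht : 0 < t) (hr : 0 < r) (h : r ^ 2 = t ^ 2 * (1 + m ^ 2)) :
    Rr m = √2 * r / t := by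
  unfold Rr
  rw [Real.sqrt_eq_iff_mul_self_eq_of_pos (by positivity)]
  have : √2 ^ 2 = 2 := Real.sq_sqrt (by norm_num)
  field_simp
  rw [this, h]; ring

lemma X_scale {t r m : ℝ} (ht : 0 < t) (hr : 0 < r) (h : r ^ 2 = t ^ 2 * (1 + m ^ 2)) :
    Xf m = m * t * (3 * t ^ 2 + (m * t) ^ 2) / (√2 * r ^ 3) := by
  unfold Xf
  rw [sq_scale ht hr h]
  have : √2 ^ 2 = 2 := Real.sq_sqrt (by norm_num)
  have h2 : √2 ^ 3 = 2 * √2 := by rw [pow_succ, this]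
  have : 0 < √2 := by positivity
  rw [div_pow, mul_pow, h2]
  field_simp

lemma Y_scale {t r m : ℝ} (ht : 0 < t) (hr : 0 < r) (h : r ^ 2 = t ^ 2 * (1 + m ^ 2)) :
    Yf m = t * (t ^ 2 + 3 * (m * t) ^ 2) / (√2 * r ^ 3) := by
  unfold Yf
  rw [sq_scale ht hr h]
  have : √2 ^ 2 = 2 := Real.sq_sqrt (by norm_num)
  have h2 : √2 ^ 3 = 2 * √2 := by rw [pow_succ, this]
  have : 0 < √2 := by positivity
  rw [div_pow, mul_pow, h2]
  field_simp

lemma fd_div {E : Type*} [NormedAddCommGroup E] [NormedSpace ℝ E] {f g : E → ℝ} {f' g' : E →L[ℝ] ℝ}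
    {x : E} (hf : HasFDerivAt f f' x) (hg : HasFDerivAt g g' x) (h : g x ≠ 0) :
    HasFDerivAt (fun y => f y / g y) ((1 / g x) • f' - (f x / g x ^ 2) • g') x := by
  have := hf.mul ((hasDerivAt_inv h).comp_hasFDerivAt x hg)
  refine (this.congr_of_eventuallyEq (Eventually.of_forall fun y => ?_)).congr_fderiv ?_
  · simp [div_eq_mul_inv]
  · ext v
    simp
    field_simp
    ring

lemma w2_grad {x : EuclideanSpace ℝ (Fin 2)} (hx : x 0 ^ 2 + x 1 ^ 2 = 1) :
    HasGradientAt w2 (pt (-(x 0) * (x 0 ^ 2 + 3 * x 1 ^ 2) / √2)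
      (x 1 * (3 * x 0 ^ 2 + x 1 ^ 2) / √2)) x := by
  have h2 : √2 ^ 2 = 2 := Real.sq_sqrt (by norm_num)
  have h2p : 0 < √2 := by positivity
  have hs : √(2 * (x 0 ^ 2 + x 1 ^ 2)) = √2 := by rw [hx, mul_one]
  have hn := (((proj2 1 x).pow 2).sub ((proj2 0 x).pow 2))
  have hd := ((((proj2 0 x).pow 2).add ((proj2 1 x).pow 2)).const_mul 2).sqrt
    (by simp only [Pi.add_apply, hx]; norm_num)
  have := fd_div hn hd (by simp only [Pi.add_apply, Pi.pow_apply, hs]; positivity)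
  refine grad2 (this.congr_of_eventuallyEq (Eventually.of_forall fun y => ?_)) ?_
  · simp [w2]
  · intro v
    simp [hs, hx]
    field_simp
    have : x 0 ^ 2 = 1 - x 1 ^ 2 := by linarith
    have e : x 0 ^ 3 = x 0 * (1 - x 1 ^ 2) := by rw [← this]; ring
    ring_nf
    simp only [h2, this, e]
    ring

lemma Ga_param {p : EuclideanSpace ℝ (Fin 2)} (hp : p ∈ Ga) :
    ∃ m ∈ Icc (-1 : ℝ) 1, ∃ σ : ℝ, (σ = 1 ∨ σ = -1) ∧
      (p = pt (Xf m) (σ * Yf m) ∨ p = pt (σ * Yf m) (Xf m)) := by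
  obtain ⟨x, hx, rfl⟩ := hp
  have hx2 : x 0 ^ 2 + x 1 ^ 2 = 1 := by rw [← norm2, hx]; norm_num
  rw [(w2_grad hx2).gradient]
  set c := x 0
  set s := x 1
  have sgn : ∀ y : ℝ, y ≠ 0 → ∃ σ : ℝ, (σ = 1 ∨ σ = -1) ∧ ∃ t > 0, y = σ * t ∧ |y| = t := by
    intro y hy
    rcases lt_or_gt_of_ne hy with h | h
    · exact ⟨-1, Or.inr rfl, -y, by linarith, by ring, abs_of_neg h⟩
    · exact ⟨1, Or.inl rfl, y, h, by ring, abs_of_pos h⟩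
  rcases le_total |c| |s| with h | h
  · have hs : s ≠ 0 := by
      rintro h0
      rw [h0, abs_zero] at h
      have := abs_eq_zero.1 (le_antisymm h (abs_nonneg c))
      rw [this, h0] at hx2; norm_num at hx2
    obtain ⟨σ, hσ, t, ht, hst, habs⟩ := sgn s hs
    have hσ2 : σ ^ 2 = 1 := by rcases hσ with rfl | rfl <;> norm_num
    have hr : (1:ℝ) ^ 2 = t ^ 2 * (1 + (-c / t) ^ 2) := by
      field_simp; rw [hst, mul_pow, hσ2] at hx2; linarith
    refine ⟨-c / t, ?_, σ, hσ, Or.inl ?_⟩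
    · rw [habs] at h
      have := abs_le.1 h
      constructor
      · rw [le_div_iff₀ ht]; linarith
      · rw [div_le_iff₀ ht]; linarith
    · rw [X_scale ht one_pos hr, Y_scale ht one_pos hr, div_mul_cancel₀ _ ht.ne', hst]
      congr 1
      · rw [mul_pow, hσ2]; ring
      · rw [mul_pow, hσ2]; ring
  · have hs : c ≠ 0 := by
      rintro h0
      rw [h0, abs_zero] at h
      have := abs_eq_zero.1 (le_antisymm h (abs_nonneg s))
      rw [this, h0] at hx2; norm_num at hx2
    obtain ⟨σ, hσ, t, ht, hst, habs⟩ := sgn c hs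
    have hσ2 : σ ^ 2 = 1 := by rcases hσ with rfl | rfl <;> norm_num
    have hr : (1:ℝ) ^ 2 = t ^ 2 * (1 + (s / t) ^ 2) := by
      field_simp; rw [hst, mul_pow, hσ2] at hx2; linarith
    refine ⟨s / t, ?_, -σ, by rcases hσ with rfl | rfl <;> norm_num, Or.inr ?_⟩
    · rw [habs] at h
      have := abs_le.1 h
      constructor
      · rw [le_div_iff₀ ht]; linarith
      · rw [div_le_iff₀ ht]; linarith
    · rw [X_scale ht one_pos hr, Y_scale ht one_pos hr, div_mul_cancel₀ _ ht.ne', hst]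
      congr 1
      · rw [mul_pow, hσ2]; ring
      · rw [mul_pow, hσ2]; ring


/-! ### The function `H` -/

def Tf (p : EuclideanSpace ℝ (Fin 2)) : ℝ := ((|p 1| + p 0) / (|p 1| - p 0)) ^ (((3 : ℕ) : ℝ)⁻¹)
def muf (p : EuclideanSpace ℝ (Fin 2)) : ℝ := (Tf p - 1) / (Tf p + 1)

def ell (a m s t : ℝ) : ℝ := s * (Qf a m - m * Kf a m) + (t - Wf m) * Kf a m - Ef a m

open Classical in
def Hf (a : ℝ) (p : EuclideanSpace ℝ (Fin 2)) : ℝ :=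
  if |p 0| < |p 1| then ell a (muf p) (p 0) |p 1| else Qf a 1 * |p 0| - Ef a 1

def D1 : Set (EuclideanSpace ℝ (Fin 2)) := {p | |p 0| < |p 1|}
def D4 (a : ℝ) : Set (EuclideanSpace ℝ (Fin 2)) :=
  {p | 0 < p 0 ∧ |p 1| - p 0 < (a / 4) ^ 3 * (|p 1| + p 0)}
def D2 (a : ℝ) : Set (EuclideanSpace ℝ (Fin 2)) :=
  {p | p 0 < 0 ∧ |p 1| + p 0 < (a / 4) ^ 3 * (|p 1| - p 0)}

lemma D1_open : IsOpen D1 := isOpen_lt (by fun_prop) (by fun_prop)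
lemma D4_open (a : ℝ) : IsOpen (D4 a) := by
  unfold D4
  rw [setOf_and]
  exact IsOpen.inter (isOpen_lt (by fun_prop) (by fun_prop)) (isOpen_lt (by fun_prop) (by fun_prop))
lemma D2_open (a : ℝ) : IsOpen (D2 a) := by
  unfold D2
  rw [setOf_and]
  exact IsOpen.inter (isOpen_lt (by fun_prop) (by fun_prop)) (isOpen_lt (by fun_prop) (by fun_prop))

lemma D1_pos {p : EuclideanSpace ℝ (Fin 2)} (hp : p ∈ D1) : 0 < |p 1| + p 0 ∧ 0 < |p 1| - p 0 := by
  have hp : |p 0| < |p 1| := hp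
  have := abs_lt.1 hp
  exact ⟨by linarith [this.1], by linarith [this.2]⟩

lemma Tf_cube {p : EuclideanSpace ℝ (Fin 2)} (hp : p ∈ D1) :
    0 < Tf p ∧ Tf p ^ 3 = (|p 1| + p 0) / (|p 1| - p 0) := by
  have := D1_pos hp
  have hq : 0 < (|p 1| + p 0) / (|p 1| - p 0) := div_pos this.1 this.2
  exact ⟨Real.rpow_pos_of_pos hq _, Real.rpow_inv_natCast_pow hq.le (by norm_num)⟩

lemma muf_contDiffAt {p : EuclideanSpace ℝ (Fin 2)} (hp : p ∈ D1) :
    ContDiffAt ℝ (⊤ : ℕ∞) muf p := by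
  have hpos := D1_pos hp
  have hT := (Tf_cube hp).1
  have h0 : ContDiffAt ℝ (⊤ : ℕ∞) (fun p : EuclideanSpace ℝ (Fin 2) => p 0) p := by fun_prop
  have h1 : ContDiffAt ℝ (⊤ : ℕ∞) (fun p : EuclideanSpace ℝ (Fin 2) => |p 1|) p := by
    have : p 1 ≠ 0 := by
      intro h
      have hp : |p 0| < |p 1| := hp
      rw [h, abs_zero] at hp
      exact absurd hp (not_lt.2 (abs_nonneg _))
    have h1 : ContDiffAt ℝ (⊤ : ℕ∞) (fun p : EuclideanSpace ℝ (Fin 2) => p 1) p := by fun_prop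
    exact h1.abs this
  have hT' : ContDiffAt ℝ (⊤ : ℕ∞) Tf p :=
    ((h1.add h0).div (h1.sub h0) hpos.2.ne').rpow_const_of_ne (div_pos hpos.1 hpos.2).ne'
  exact (hT'.sub contDiffAt_const).div (hT'.add contDiffAt_const) (by positivity)

lemma curve_D1 {m σ : ℝ} (hm : m ∈ Ioo (-1 : ℝ) 1) (hσ : σ = 1 ∨ σ = -1) :
    pt (Xf m) (σ * Yf m) ∈ D1 := by
  have h := absX_lt_Y hm
  have hY := Yf_ge ⟨hm.1.le, hm.2.le⟩
  have : |σ * Yf m| = Yf m := by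
    rcases hσ with rfl | rfl <;> simp <;> linarith
  show |pt _ _ 0| < |pt _ _ 1|
  rw [pt_zero, pt_one, this]; exact h

lemma muf_curve {m σ : ℝ} (hm : m ∈ Ioo (-1 : ℝ) 1) (hσ : σ = 1 ∨ σ = -1) :
    muf (pt (Xf m) (σ * Yf m)) = m := by
  have hD := curve_D1 hm hσ
  obtain ⟨hT, hc⟩ := Tf_cube hD
  have hY := Yf_ge ⟨hm.1.le, hm.2.le⟩
  have h1 : |σ * Yf m| = Yf m := by
    rcases hσ with rfl | rfl <;> simp <;> linarith
  rw [pt_zero, pt_one, h1, YX_add, YX_sub] at hc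
  have ha : 0 < 1 + m := by linarith [hm.1]
  have hb : 0 < 1 - m := by linarith [hm.2]
  have hR := Rr_pos m
  have e : Tf (pt (Xf m) (σ * Yf m)) = (1 + m) / (1 - m) := by
    rw [← pow_left_inj₀ hT.le (by positivity) (by norm_num : (3 : ℕ) ≠ 0)]
    rw [hc]; field_simp
  unfold muf
  rw [e]; field_simp; ring

lemma Hf_D1 (a : ℝ) {p : EuclideanSpace ℝ (Fin 2)} (hp : p ∈ D1) :
    Hf a p = ell a (muf p) (p 0) |p 1| := if_pos hp

lemma Hf_D4 {a : ℝ} (ha : 0 < a) {p : EuclideanSpace ℝ (Fin 2)} (hp : p ∈ D4 a) :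
    Hf a p = Qf a 1 * p 0 + -Ef a 1 := by
  by_cases hD : p ∈ D1
  · rw [Hf_D1 a hD]
    obtain ⟨hT, hc⟩ := Tf_cube hD
    have hpos := D1_pos hD
    have h1 : (4 / a) ^ 3 < Tf p ^ 3 := by
      rw [hc, lt_div_iff₀ hpos.2]
      have := hp.2
      calc (4 / a) ^ 3 * (|p 1| - p 0) < (4 / a) ^ 3 * ((a / 4) ^ 3 * (|p 1| + p 0)) := by gcongr
        _ = _ := by field_simp
    have h2 : 4 / a < Tf p := lt_of_pow_lt_pow_left₀ 3 hT.le h1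
    rw [div_lt_iff₀ ha] at h2
    have h0 : (|p 1| - p 0) ≤ (|p 1| + p 0) := by linarith [hp.1]
    have hT1 : 1 ≤ Tf p := by
      by_contra hlt
      have : Tf p ^ 3 < 1 := pow_lt_one₀ hT.le (not_le.1 hlt) (by norm_num)
      rw [hc, div_lt_one hpos.2] at this
      linarith
    have hmu0 : 0 ≤ muf p := div_nonneg (by linarith) (by linarith)
    have hmu : 1 - muf p ^ 2 ≤ a := by
      have : 1 - muf p ^ 2 = 4 * Tf p / (Tf p + 1) ^ 2 := by unfold muf; field_simp; ring
      rw [this, div_le_iff₀ (by positivity)]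
      nlinarith
    unfold ell
    rw [Kf_zero ha hmu, Qf_const ha hmu0 hmu, Ef_const ha hmu0 hmu]; ring
  · unfold Hf
    rw [if_neg (show ¬ |p 0| < |p 1| from hD), abs_of_pos hp.1]; ring

lemma Hf_D2 {a : ℝ} (ha : 0 < a) {p : EuclideanSpace ℝ (Fin 2)} (hp : p ∈ D2 a) :
    Hf a p = -Qf a 1 * p 0 + -Ef a 1 := by
  by_cases hD : p ∈ D1
  · rw [Hf_D1 a hD]
    obtain ⟨hT, hc⟩ := Tf_cube hD
    have hpos := D1_pos hD
    have h1 : Tf p ^ 3 < (a / 4) ^ 3 := by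
      rw [hc, div_lt_iff₀ hpos.2]; exact hp.2
    have h2 : Tf p < a / 4 := lt_of_pow_lt_pow_left₀ 3 (by positivity) h1
    have hT1 : Tf p ≤ 1 := by
      by_contra hlt
      have : 1 < Tf p ^ 3 := one_lt_pow₀ (not_le.1 hlt) (by norm_num)
      rw [hc, one_lt_div hpos.2] at this
      linarith [hp.1]
    have hmu0 : 0 ≤ -muf p := by
      unfold muf; rw [← neg_div]; exact div_nonneg (by linarith) (by linarith)
    have hmu : 1 - (-muf p) ^ 2 ≤ a := by
      have : 1 - (-muf p) ^ 2 = 4 * Tf p / (Tf p + 1) ^ 2 := by unfold muf; field_simp; ring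
      rw [this, div_le_iff₀ (by positivity)]
      nlinarith [mul_pos ha hT, mul_pos (mul_pos ha hT) hT]
    have e1 := Kf_zero ha hmu
    have e2 := Qf_const ha hmu0 hmu
    have e3 := Ef_const ha hmu0 hmu
    rw [Kf_neg] at e1
    rw [Qf_neg] at e2
    rw [Ef_neg] at e3
    unfold ell
    rw [e1, e3, ← e2]; ring
  · unfold Hf
    rw [if_neg (show ¬ |p 0| < |p 1| from hD), abs_of_neg hp.1]; ring

lemma Hf_contDiffOn {a : ℝ} (ha : 0 < a) : ContDiffOn ℝ (⊤ : ℕ∞) (Hf a) (D1 ∪ D2 a ∪ D4 a) := by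
  intro p hp
  apply ContDiffAt.contDiffWithinAt
  rcases hp with (hp | hp) | hp
  · have e : Hf a =ᶠ[nhds p] fun p => ell a (muf p) (p 0) |p 1| :=
      (D1_open.eventually_mem hp).mono fun q hq => Hf_D1 a hq
    refine ContDiffAt.congr_of_eventuallyEq ?_ e
    have hmu := muf_contDiffAt hp
    have h0 : ContDiffAt ℝ (⊤ : ℕ∞) (fun p : EuclideanSpace ℝ (Fin 2) => p 0) p := by fun_prop
    have h1 : ContDiffAt ℝ (⊤ : ℕ∞) (fun p : EuclideanSpace ℝ (Fin 2) => |p 1|) p := by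
      have : p 1 ≠ 0 := by
        intro h
        have hp : |p 0| < |p 1| := hp
        rw [h, abs_zero] at hp
        exact absurd hp (not_lt.2 (abs_nonneg _))
      have h1 : ContDiffAt ℝ (⊤ : ℕ∞) (fun p : EuclideanSpace ℝ (Fin 2) => p 1) p := by fun_prop
      exact h1.abs this
    have hK := (Kf_contDiff a).contDiffAt.comp p hmu
    have hQ := (Qf_contDiff a).contDiffAt.comp p hmu
    have hE := (Ef_contDiff a).contDiffAt.comp p hmu
    have hW := Wf_contDiff.contDiffAt.comp p hmu
    exact ((h0.mul (hQ.sub (hmu.mul hK))).add ((h1.sub hW).mul hK)).sub hE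
  · have e : Hf a =ᶠ[nhds p] fun p => -Qf a 1 * p 0 + -Ef a 1 :=
      ((D2_open a).eventually_mem hp).mono fun q hq => Hf_D2 ha hq
    refine ContDiffAt.congr_of_eventuallyEq ?_ e
    fun_prop
  · have e : Hf a =ᶠ[nhds p] fun p => Qf a 1 * p 0 + -Ef a 1 :=
      ((D4_open a).eventually_mem hp).mono fun q hq => Hf_D4 ha hq
    refine ContDiffAt.congr_of_eventuallyEq ?_ e
    fun_prop

lemma Hf_grad_D4 {a : ℝ} (ha : 0 < a) {p : EuclideanSpace ℝ (Fin 2)} (hp : p ∈ D4 a) :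
    HasGradientAt (Hf a) (pt (Qf a 1) 0) p := by
  have e : Hf a =ᶠ[nhds p] fun p => Qf a 1 * p 0 + -Ef a 1 :=
    ((D4_open a).eventually_mem hp).mono fun q hq => Hf_D4 ha hq
  refine grad2 ((((proj2 0 p).const_mul (Qf a 1)).add_const _).congr_of_eventuallyEq e) ?_
  intro v; simp

lemma Hf_grad_D2 {a : ℝ} (ha : 0 < a) {p : EuclideanSpace ℝ (Fin 2)} (hp : p ∈ D2 a) :
    HasGradientAt (Hf a) (pt (-Qf a 1) 0) p := by
  have e : Hf a =ᶠ[nhds p] fun p => -Qf a 1 * p 0 + -Ef a 1 :=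
    ((D2_open a).eventually_mem hp).mono fun q hq => Hf_D2 ha hq
  refine grad2 ((((proj2 0 p).const_mul (-Qf a 1)).add_const _).congr_of_eventuallyEq e) ?_
  intro v; simp

lemma Yf_pos (m : ℝ) : 0 < Yf m := by
  have := Rr_pos m
  unfold Yf; positivity

lemma curve_D4 {a m σ : ℝ} (ha : 0 < a) (hm : 1 ≤ m) (hσ : σ = 1 ∨ σ = -1) :
    pt (Xf m) (σ * Yf m) ∈ D4 a := by
  have hR := Rr_pos m
  have hY := Yf_pos m
  have h1 : |σ * Yf m| = Yf m := by
    rcases hσ with rfl | rfl <;> simp <;> linarith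
  have hX : 0 < Xf m := by unfold Xf; positivity
  have h2 : Yf m - Xf m ≤ 0 := by
    rw [YX_sub]
    have : (1 - m) ^ 3 ≤ 0 := Odd.pow_nonpos (by decide) (by linarith)
    exact div_nonpos_of_nonpos_of_nonneg (by linarith) (by positivity)
  refine ⟨by rw [pt_zero]; exact hX, ?_⟩
  rw [pt_zero, pt_one, h1]
  exact lt_of_le_of_lt h2 (by positivity)

lemma curve_D2 {a m σ : ℝ} (ha : 0 < a) (hm : m ≤ -1) (hσ : σ = 1 ∨ σ = -1) :
    pt (Xf m) (σ * Yf m) ∈ D2 a := by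
  have := curve_D4 (m := -m) ha (by linarith) hσ
  rw [Xf_neg, Yf_neg] at this
  obtain ⟨h1, h2⟩ := this
  rw [pt_zero] at h1 h2
  rw [pt_one] at h2
  refine ⟨by rw [pt_zero]; linarith, ?_⟩
  rw [pt_zero, pt_one]
  linarith

lemma abs_deriv_sgn {σ y : ℝ} (hy : 0 < y) (hσ : σ = 1 ∨ σ = -1) :
    HasDerivAt (fun x : ℝ => |x|) σ (σ * y) := by
  rcases hσ with rfl | rfl
  · exact hasDerivAt_abs_pos (by linarith)
  · exact hasDerivAt_abs_neg (by linarith)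

/-- The gradient of `H` at the points `(X(m), σ Y(m))`. -/
lemma Hf_grad1 {a m σ : ℝ} (ha : 0 < a) (hσ : σ = 1 ∨ σ = -1) :
    HasGradientAt (Hf a) (pt (Qf a m - m * Kf a m) (σ * Kf a m)) (pt (Xf m) (σ * Yf m)) := by
  by_cases h1 : 1 ≤ m
  · have h := Hf_grad_D4 ha (curve_D4 ha h1 hσ)
    have hz : 1 - m ^ 2 ≤ a := by nlinarith
    rw [Kf_zero ha hz, Qf_const ha (by linarith) hz]
    simpa using h
  by_cases h2 : m ≤ -1
  · have h := Hf_grad_D2 ha (curve_D2 ha h2 hσ)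
    have hz : 1 - (-m) ^ 2 ≤ a := by nlinarith
    have e := Qf_const ha (by linarith) hz
    have e2 := Kf_zero ha hz
    rw [Kf_neg] at e2
    rw [Qf_neg] at e
    rw [e2, ← neg_neg (Qf a m), e]
    simpa using h
  have hm : m ∈ Ioo (-1 : ℝ) 1 := ⟨not_le.1 h2, not_le.1 h1⟩
  have hD := curve_D1 hm hσ
  have hmu := muf_curve hm hσ
  set p := pt (Xf m) (σ * Yf m) with hp
  have e : Hf a =ᶠ[nhds p] fun p => ell a (muf p) (p 0) |p 1| :=
      (D1_open.eventually_mem hD).mono fun q hq => Hf_D1 a hq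
  have hM := ((muf_contDiffAt hD).differentiableAt (by simp)).hasFDerivAt
  set M := fderiv ℝ muf p
  have hp1 : p 1 = σ * Yf m := pt_one _ _
  have hp0 : p 0 = Xf m := pt_zero _ _
  have hY := Yf_pos m
  have hab0 : HasDerivAt (fun x : ℝ => |x|) σ (p 1) := by rw [hp1]; exact abs_deriv_sgn hY hσ
  have hab := hab0.comp_hasFDerivAt p (proj2 1 p)
  have hK := (Kf_deriv a (muf p)).comp_hasFDerivAt p hM
  have hQ := (Qf_deriv a (muf p)).comp_hasFDerivAt p hM
  have hE := (Ef_deriv a (muf p)).comp_hasFDerivAt p hM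
  have hW := (Wf_deriv (muf p)).comp_hasFDerivAt p hM
  have := (((proj2 0 p).mul (hQ.sub (hM.mul hK))).add ((hab.sub hW).mul hK)).sub hE
  refine grad2 (this.congr_of_eventuallyEq (e.trans (Eventually.of_forall fun q => ?_))) ?_
  · simp [ell]
  · intro v
    have habs : |σ * Yf m| = Yf m := by
      rcases hσ with rfl | rfl <;> simp <;> linarith
    have hWe := Wf_eq m
    simp [hmu, hp0, hp1, habs]
    rw [hWe]
    have : |σ| = 1 := by rcases hσ with rfl | rfl <;> simp
    simp [this, abs_of_pos hY]
    ring

lemma Hf_val1 {a m σ : ℝ} (ha : 0 < a) (hσ : σ = 1 ∨ σ = -1) :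
    Hf a (pt (Xf m) (σ * Yf m)) = Xf m * Qf a m - Ef a m := by
  by_cases h1 : 1 ≤ m
  · rw [Hf_D4 ha (curve_D4 ha h1 hσ), pt_zero]
    have hz : 1 - m ^ 2 ≤ a := by nlinarith
    rw [Qf_const ha (by linarith) hz, Ef_const ha (by linarith) hz]
    ring
  by_cases h2 : m ≤ -1
  · rw [Hf_D2 ha (curve_D2 ha h2 hσ), pt_zero]
    have hz : 1 - (-m) ^ 2 ≤ a := by nlinarith
    have e := Qf_const ha (by linarith) hz
    have e2 := Ef_const ha (by linarith) hz
    rw [Ef_neg] at e2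
    rw [Qf_neg] at e
    rw [e2, ← e]
    ring
  have hm : m ∈ Ioo (-1 : ℝ) 1 := ⟨not_le.1 h2, not_le.1 h1⟩
  rw [Hf_D1 a (curve_D1 hm hσ), muf_curve hm hσ, pt_zero, pt_one]
  have habs : |σ * Yf m| = Yf m := by
    have := Yf_pos m
    rcases hσ with rfl | rfl <;> simp <;> linarith
  rw [habs]
  unfold ell
  rw [Wf_eq]; ring

lemma curve2_D4 {a m : ℝ} (ha : 0 < a) (hm : m ∈ Icc (-1 : ℝ) 1) : pt (Yf m) (Xf m) ∈ D4 a := by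
  have hY := Yf_pos m
  have := absX_le_Y hm
  refine ⟨by rw [pt_zero]; exact hY, ?_⟩
  rw [pt_zero, pt_one]
  have : 0 < (a / 4) ^ 3 * (|Xf m| + Yf m) := by positivity
  linarith

lemma curve2_D2 {a m : ℝ} (ha : 0 < a) (hm : m ∈ Icc (-1 : ℝ) 1) : pt (-Yf m) (Xf m) ∈ D2 a := by
  have hY := Yf_pos m
  have := absX_le_Y hm
  refine ⟨by rw [pt_zero]; linarith, ?_⟩
  rw [pt_zero, pt_one]
  have : 0 < (a / 4) ^ 3 * (|Xf m| - -Yf m) := by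
    rw [sub_neg_eq_add]; positivity
  linarith

lemma Hf_val2 {a m σ : ℝ} (ha : 0 < a) (hm : m ∈ Icc (-1 : ℝ) 1) (hσ : σ = 1 ∨ σ = -1) :
    Hf a (pt (σ * Yf m) (Xf m)) = Qf a 1 * Yf m - Ef a 1 := by
  rcases hσ with rfl | rfl
  · have := Hf_D4 ha (curve2_D4 ha hm)
    rw [pt_zero] at this
    rw [one_mul, this]; ring
  · have := Hf_D2 ha (curve2_D2 ha hm)
    rw [pt_zero] at this
    rw [neg_one_mul, this]; ring

lemma Hf_grad2 {a m σ : ℝ} (ha : 0 < a) (hm : m ∈ Icc (-1 : ℝ) 1) (hσ : σ = 1 ∨ σ = -1) :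
    HasGradientAt (Hf a) (pt (σ * Qf a 1) 0) (pt (σ * Yf m) (Xf m)) := by
  rcases hσ with rfl | rfl
  · rw [one_mul, one_mul]; exact Hf_grad_D4 ha (curve2_D4 ha hm)
  · rw [neg_one_mul, neg_one_mul]; exact Hf_grad_D2 ha (curve2_D2 ha hm)


/-! ### Separation of `H` on the curve -/

def SH (a : ℝ) (p q : EuclideanSpace ℝ (Fin 2)) : ℝ :=
  Hf a q - Hf a p - ⟪gradient (Hf a) p, q - p⟫

lemma sgn_sq {σ : ℝ} (hσ : σ = 1 ∨ σ = -1) : σ * σ = 1 := by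
  rcases hσ with rfl | rfl <;> norm_num

lemma SH11 {a m n σ τ : ℝ} (ha : 0 < a) (hσ : σ = 1 ∨ σ = -1) (hτ : τ = 1 ∨ τ = -1) :
    SH a (pt (Xf m) (σ * Yf m)) (pt (Xf n) (τ * Yf n)) =
      Sf a m n + Kf a m * Yf n * (1 - σ * τ) := by
  unfold SH
  rw [(Hf_grad1 ha hσ).gradient, Hf_val1 ha hσ, Hf_val1 ha hτ, inner2]
  simp only [PiLp.sub_apply, pt_zero, pt_one]
  unfold Sf Dg
  rw [Wf_eq]
  linear_combination (Kf a m * Yf m) * sgn_sq hσ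

lemma SH12 {a m n σ τ : ℝ} (ha : 0 < a) (hn : n ∈ Icc (-1 : ℝ) 1)
    (hσ : σ = 1 ∨ σ = -1) (hτ : τ = 1 ∨ τ = -1) :
    SH a (pt (Xf m) (σ * Yf m)) (pt (τ * Yf n) (Xf n)) =
      S4 a (τ * m) (Yf n) (σ * Xf n) := by
  unfold SH
  rw [(Hf_grad1 ha hσ).gradient, Hf_val1 ha hσ, Hf_val2 ha hn hτ, inner2]
  simp only [PiLp.sub_apply, pt_zero, pt_one]
  unfold S4
  rcases hτ with rfl | rfl
  · simp only [one_mul, Wf_eq]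
    linear_combination (Kf a m * Yf m) * sgn_sq hσ
  · simp only [neg_one_mul, Qf_neg, Ef_neg, Xf_neg, Yf_neg, Kf_neg, Wf_eq]
    linear_combination (Kf a m * Yf m) * sgn_sq hσ

lemma SH21 {a m n σ τ : ℝ} (ha : 0 < a) (hm : m ∈ Icc (-1 : ℝ) 1)
    (hσ : σ = 1 ∨ σ = -1) (hτ : τ = 1 ∨ τ = -1) :
    SH a (pt (σ * Yf m) (Xf m)) (pt (Xf n) (τ * Yf n)) = Rf a (σ * n) := by
  unfold SH
  rw [(Hf_grad2 ha hm hσ).gradient, Hf_val2 ha hm hσ, Hf_val1 ha hτ, inner2]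
  simp only [PiLp.sub_apply, pt_zero, pt_one]
  unfold Rf
  rcases hσ with rfl | rfl
  · simp only [one_mul]; ring
  · simp only [neg_one_mul, Qf_neg, Ef_neg, Xf_neg]; ring

lemma SH22 {a m n σ τ : ℝ} (ha : 0 < a) (hm : m ∈ Icc (-1 : ℝ) 1) (hn : n ∈ Icc (-1 : ℝ) 1)
    (hσ : σ = 1 ∨ σ = -1) (hτ : τ = 1 ∨ τ = -1) :
    SH a (pt (σ * Yf m) (Xf m)) (pt (τ * Yf n) (Xf n)) = Qf a 1 * Yf n * (1 - σ * τ) := by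
  unfold SH
  rw [(Hf_grad2 ha hm hσ).gradient, Hf_val2 ha hm hσ, Hf_val2 ha hn hτ, inner2]
  simp only [PiLp.sub_apply, pt_zero, pt_one]
  linear_combination (Qf a 1 * Yf m) * sgn_sq hσ

lemma sgn_mem {σ m : ℝ} (hσ : σ = 1 ∨ σ = -1) (hm : m ∈ Icc (-1 : ℝ) 1) :
    σ * m ∈ Icc (-1 : ℝ) 1 := by
  rcases hσ with rfl | rfl
  · simpa using hm
  · exact ⟨by linarith [hm.2], by linarith [hm.1]⟩

lemma sgn_abs {σ : ℝ} (hσ : σ = 1 ∨ σ = -1) (x : ℝ) : |σ * x| = |x| := by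
  rcases hσ with rfl | rfl <;> simp

lemma sgn_X {σ m : ℝ} (hσ : σ = 1 ∨ σ = -1) : Xf (σ * m) = σ * Xf m := by
  rcases hσ with rfl | rfl
  · simp
  · rw [neg_one_mul, neg_one_mul, Xf_neg]

lemma sgn_prod {σ τ : ℝ} (hσ : σ = 1 ∨ σ = -1) (hτ : τ = 1 ∨ τ = -1) : 0 ≤ 1 - σ * τ := by
  rcases hσ with rfl | rfl <;> rcases hτ with rfl | rfl <;> norm_num

lemma sep5 {a ε : ℝ} (h0 : 0 < a) (ha : a ≤ 1 / 200) (hε : 16 * a ≤ ε)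
    {p q : EuclideanSpace ℝ (Fin 2)} (hp : p ∈ Ga) (hq : q ∈ Ga) :
    -ε * ‖p - q‖ ^ 2 ≤ SH a p q := by
  have hε0 : 0 ≤ ε := by linarith
  have hneg : -ε * ‖p - q‖ ^ 2 ≤ 0 := by nlinarith [sq_nonneg ‖p - q‖]
  have hb : -ε * ‖p - q‖ ^ 2 ≤ -ε * (q 0 - p 0) ^ 2 := by
    rw [norm2]
    simp only [PiLp.sub_apply]
    nlinarith [mul_nonneg hε0 (sq_nonneg (p 1 - q 1))]
  obtain ⟨m, hm, σ, hσ, hp'⟩ := Ga_param hp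
  obtain ⟨n, hn, τ, hτ, hq'⟩ := Ga_param hq
  have hYn := Yf_pos n
  rcases hp' with hp' | hp' <;> rcases hq' with hq' | hq'
  · refine hb.trans ?_
    rw [hp', hq', SH11 h0 hσ hτ, pt_zero, pt_zero]
    have h1 := Sf_ge h0 ha hε hm hn
    have h2 : 0 ≤ Kf a m * Yf n * (1 - σ * τ) :=
      mul_nonneg (mul_nonneg (Kf_nonneg h0 m) hYn.le) (sgn_prod hσ hτ)
    linarith
  · refine hb.trans ?_
    rw [hp', hq', SH12 h0 hn hσ hτ, pt_zero, pt_zero]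
    have hle : σ * Xf n ≤ Yf n := by
      have := absX_le_Y hn
      have := le_abs_self (σ * Xf n)
      rw [sgn_abs hσ] at this; linarith
    have := S4_main h0 ha hε (sgn_mem hτ hm) hle (Wf_zero_le_Y hn) (Yf_le hn)
    rw [sgn_X hτ] at this
    have e : (τ * Yf n - Xf m) ^ 2 = (Yf n - τ * Xf m) ^ 2 := by
      rcases hτ with rfl | rfl <;> ring
    rw [e]; exact this
  · refine hneg.trans ?_
    rw [hp', hq', SH21 h0 hm hσ hτ]
    exact Rf_nonneg h0 (sgn_mem hσ hn)
  · refine hneg.trans ?_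
    rw [hp', hq', SH22 h0 hm hn hσ hτ]
    exact mul_nonneg (mul_nonneg (Qf_one_nonneg h0) hYn.le) (sgn_prod hσ hτ)

lemma Ga_bound {p : EuclideanSpace ℝ (Fin 2)} (hp : p ∈ Ga) : |p 0| ≤ 1 ∧ |p 1| ≤ 1 := by
  obtain ⟨m, hm, σ, hσ, hp'⟩ := Ga_param hp
  have hY := Yf_le hm
  have hX := absX_le_Y hm
  have hYa : |Yf m| = Yf m := abs_of_pos (Yf_pos m)
  rcases hp' with rfl | rfl <;> rw [pt_zero, pt_one, sgn_abs hσ, hYa] <;>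
    constructor <;> linarith

lemma sep4 {a : ℝ} (h0 : 0 < a) (ha : a ≤ 1 / 200) {m : ℝ} (hm : |m| ≤ 1 / 4)
    (hp : pt (Xf m) (Yf m) ∈ Ga) {q : EuclideanSpace ℝ (Fin 2)} (hq : q ∈ Ga) :
    1 / 4000000 * ‖pt (Xf m) (Yf m) - q‖ ^ 2 ≤ SH a (pt (Xf m) (Yf m)) q := by
  have hm' := abs_le.1 hm
  have hmI : m ∈ Icc (-1 : ℝ) 1 := ⟨by linarith [hm'.1], by linarith [hm'.2]⟩
  have h8 : ‖pt (Xf m) (Yf m) - q‖ ^ 2 ≤ 8 := by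
    rw [norm2]
    simp only [PiLp.sub_apply]
    obtain ⟨a1, a2⟩ := Ga_bound hp
    obtain ⟨b1, b2⟩ := Ga_bound hq
    rw [abs_le] at a1 a2 b1 b2
    have e1 : (pt (Xf m) (Yf m) 0 - q 0) ^ 2 ≤ 2 ^ 2 :=
      sq_le_sq' (by linarith [a1.1, b1.2]) (by linarith [a1.2, b1.1])
    have e2 : (pt (Xf m) (Yf m) 1 - q 1) ^ 2 ≤ 2 ^ 2 :=
      sq_le_sq' (by linarith [a2.1, b2.2]) (by linarith [a2.2, b2.1])
    linarith
  obtain ⟨n, hn, τ, hτ, hq'⟩ := Ga_param hq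
  have hYn := Yf_ge hn
  have h1 : (1:ℝ) = 1 ∨ (1:ℝ) = -1 := Or.inl rfl
  rcases hq' with hq' | hq'
  · have e := SH11 (m := m) (n := n) h0 h1 hτ
    rw [one_mul] at e
    have hS := Sf_mid h0 ha hm hn
    rcases hτ with rfl | rfl
    · rw [hq', e, norm2]
      simp only [PiLp.sub_apply, pt_zero, pt_one]
      have := Y_lip hmI hn
      nlinarith [sq_nonneg (Xf n - Xf m)]
    · have hK := Kf_half h0 ha hm
      have : 1 / 2 * (7 / 10) ≤ Kf a m * Yf n := mul_le_mul hK hYn (by norm_num) (by linarith)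
      rw [hq', e]
      rw [hq'] at h8
      nlinarith [sq_nonneg (Xf n - Xf m)]
  · have e := SH12 (m := m) h0 hn h1 hτ
    rw [one_mul, one_mul] at e
    rw [hq'] at h8 ⊢
    rw [e]
    have hle : Xf n ≤ Yf n := (le_abs_self _).trans (absX_le_Y hn)
    have := S4_mid h0 ha (m := τ * m) (by rwa [sgn_abs hτ]) hle (Wf_zero_le_Y hn) (Yf_le hn)
    linarith

/-- points over the middle interval. -/
lemma mid_param {p : EuclideanSpace ℝ (Fin 2)} (hp : p ∈ Ga1) (hx : |p 0| ≤ 1 / 5) :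
    ∃ m, |m| ≤ 1 / 4 ∧ p = pt (Xf m) (Yf m) := by
  obtain ⟨m, hm, σ, hσ, hp'⟩ := Ga_param hp.1
  have h2 : |p 0| ≤ p 1 := hp.2
  have hY := Yf_ge hm
  rcases hp' with rfl | rfl
  · rw [pt_zero] at hx h2
    rw [pt_one] at h2
    have := abs_nonneg (Xf m)
    have hs : σ = 1 := by
      rcases hσ with h | h
      · exact h
      · rw [h] at h2; linarith
    rw [hs, one_mul]
    refine ⟨m, ?_, rfl⟩
    rw [abs_le] at hx ⊢
    have hq := Xf_quarter_ge
    constructor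
    · by_contra h
      have := Xf_mono (a := -m) (b := 1) ⟨by linarith [hm.2], by linarith [hm.1]⟩ (by norm_num)
        (by linarith [hm.1])
      have := Xf_mono (a := 1 / 4) (b := -m) (by norm_num) ⟨by linarith [hm.2], by linarith [hm.1]⟩
        (by linarith)
      rw [Xf_neg] at this
      linarith [hx.1]
    · by_contra h
      have := Xf_mono (a := 1 / 4) (b := m) (by norm_num) hm (by linarith)
      linarith [hx.2]
  · rw [pt_zero, sgn_abs hσ, abs_of_pos (Yf_pos m)] at hx
    linarith

lemma fderiv_of_grad {f : EuclideanSpace ℝ (Fin 2) → ℝ} {x : EuclideanSpace ℝ (Fin 2)} {s t : ℝ}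
    (h : HasGradientAt f (pt s t) x) : fderiv ℝ f x (EuclideanSpace.single 1 1) = t := by
  rw [(hasGradientAt_iff_hasFDerivAt.1 h).fderiv, InnerProductSpace.toDual_apply_apply, inner2]
  simp [pt_one]

lemma H_y_mid {a m : ℝ} (h0 : 0 < a) (ha : a ≤ 1 / 200) (hm : |m| ≤ 1 / 4) :
    1 / 2 ≤ fderiv ℝ (Hf a) (pt (Xf m) (Yf m)) (EuclideanSpace.single 1 1) := by
  have h := fderiv_of_grad (Hf_grad1 (m := m) h0 (Or.inl rfl))
  rw [one_mul, one_mul] at h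
  rw [h]; exact Kf_half h0 ha hm

lemma H_y_nonneg {a : ℝ} (h0 : 0 < a) {p : EuclideanSpace ℝ (Fin 2)} (hp : p ∈ Ga1) :
    0 ≤ fderiv ℝ (Hf a) p (EuclideanSpace.single 1 1) := by
  obtain ⟨m, hm, σ, hσ, hp'⟩ := Ga_param hp.1
  have h2 : |p 0| ≤ p 1 := hp.2
  have hY := Yf_pos m
  rcases hp' with rfl | rfl
  · rw [fderiv_of_grad (Hf_grad1 h0 hσ)]
    rw [pt_zero, pt_one] at h2
    have := abs_nonneg (Xf m)
    rcases hσ with rfl | rfl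
    · rw [one_mul]; exact Kf_nonneg h0 m
    · linarith
  · rw [fderiv_of_grad (Hf_grad2 h0 hm hσ)]

lemma Ga_sub {a : ℝ} (h0 : 0 < a) : Ga ⊆ D1 ∪ D2 a ∪ D4 a := by
  intro p hp
  obtain ⟨m, hm, σ, hσ, hp'⟩ := Ga_param hp
  rcases hp' with rfl | rfl
  · by_cases h1 : 1 ≤ m
    · exact Or.inr (curve_D4 h0 h1 hσ)
    by_cases h2 : m ≤ -1
    · exact Or.inl (Or.inr (curve_D2 h0 h2 hσ))
    exact Or.inl (Or.inl (curve_D1 ⟨not_le.1 h2, not_le.1 h1⟩ hσ))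
  · rcases hσ with rfl | rfl
    · rw [one_mul]; exact Or.inr (curve2_D4 h0 hm)
    · rw [neg_one_mul]; exact Or.inl (Or.inr (curve2_D2 h0 hm))

lemma Ga_ne {p : EuclideanSpace ℝ (Fin 2)} (hp : p ∈ Ga) : p 0 ≠ 0 ∨ p 1 ≠ 0 := by
  obtain ⟨m, hm, σ, hσ, hp'⟩ := Ga_param hp
  have hY := Yf_pos m
  have : σ * Yf m ≠ 0 := by rcases hσ with rfl | rfl <;> simp <;> linarith
  rcases hp' with rfl | rfl
  · right; rwa [pt_one]
  · left; rwa [pt_zero]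

lemma Ga4_sub {a : ℝ} (h0 : 0 < a) : Ga4 ⊆ D4 a := by
  intro p hp
  have h : |p 1| ≤ p 0 := hp.2
  have hpos : 0 < p 0 := by
    rcases (abs_nonneg (p 1)).trans h |>.lt_or_eq with h' | h'
    · exact h'
    · rw [← h'] at h
      have := abs_eq_zero.1 (le_antisymm h (abs_nonneg _))
      rcases Ga_ne hp.1 with h1 | h1
      · exact absurd h'.symm h1
      · exact absurd this h1
  refine ⟨hpos, ?_⟩
  have : 0 < (a / 4) ^ 3 * (|p 1| + p 0) := by positivity
  linarith

lemma Ga2_sub {a : ℝ} (h0 : 0 < a) : Ga2 ⊆ D2 a := by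
  intro p hp
  have h : p 0 ≤ -|p 1| := hp.2
  have hpos : p 0 < 0 := by
    have := abs_nonneg (p 1)
    rcases (by linarith : p 0 ≤ 0).lt_or_eq with h' | h'
    · exact h'
    · rw [h'] at h
      have := abs_eq_zero.1 (le_antisymm (by linarith) (abs_nonneg (p 1)))
      rcases Ga_ne hp.1 with h1 | h1
      · exact absurd h' h1
      · exact absurd this h1
  refine ⟨hpos, ?_⟩
  have : 0 < (a / 4) ^ 3 * (|p 1| - p 0) := by
    have := abs_nonneg (p 1)
    exact mul_pos (by positivity) (by linarith)
  linarith


/-! ### The Euler-Lagrange equation -/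

def pt3 (a b c : ℝ) : EuclideanSpace ℝ (Fin 3) :=
  (WithLp.equiv 2 (Fin 3 → ℝ)).symm ![a, b, c]

lemma pt3_0 (a b c : ℝ) : pt3 a b c 0 = a := by simp [pt3]
lemma pt3_1 (a b c : ℝ) : pt3 a b c 1 = b := by simp [pt3]
lemma pt3_2 (a b c : ℝ) : pt3 a b c 2 = c := by simp [pt3]

lemma inner3 (p q : EuclideanSpace ℝ (Fin 3)) : ⟪p, q⟫ = p 0 * q 0 + p 1 * q 1 + p 2 * q 2 := by
  rw [PiLp.inner_apply, Fin.sum_univ_three]; simp [mul_comm]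
lemma norm3 (p : EuclideanSpace ℝ (Fin 3)) : ‖p‖ ^ 2 = p 0 ^ 2 + p 1 ^ 2 + p 2 ^ 2 := by
  rw [EuclideanSpace.norm_sq_eq, Fin.sum_univ_three]; simp

lemma proj3 (i : Fin 3) (x : EuclideanSpace ℝ (Fin 3)) :
    HasFDerivAt (fun p : EuclideanSpace ℝ (Fin 3) => p i)
      (EuclideanSpace.proj (𝕜 := ℝ) i : EuclideanSpace ℝ (Fin 3) →L[ℝ] ℝ) x :=
  (EuclideanSpace.proj (𝕜 := ℝ) i : EuclideanSpace ℝ (Fin 3) →L[ℝ] ℝ).hasFDerivAt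

lemma grad3 {f : EuclideanSpace ℝ (Fin 3) → ℝ} {x : EuclideanSpace ℝ (Fin 3)}
    {L : EuclideanSpace ℝ (Fin 3) →L[ℝ] ℝ} {a b c : ℝ}
    (h : HasFDerivAt f L x)
    (hL : ∀ v : EuclideanSpace ℝ (Fin 3), L v = a * v 0 + b * v 1 + c * v 2) :
    HasGradientAt f (pt3 a b c) x := by
  rw [hasGradientAt_iff_hasFDerivAt]
  refine h.congr_fderiv ?_
  ext v
  rw [hL, InnerProductSpace.toDual_apply_apply, inner3, pt3_0, pt3_1, pt3_2]

lemma u0_grad {x : EuclideanSpace ℝ (Fin 3)} (hx : x ≠ 0) :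
    HasGradientAt u0 (pt3
      (-(x 0) * (x 0 ^ 2 + 3 * (x 1 ^ 2 + x 2 ^ 2)) / (√2 * ‖x‖ ^ 3))
      (x 1 * (3 * x 0 ^ 2 + (x 1 ^ 2 + x 2 ^ 2)) / (√2 * ‖x‖ ^ 3))
      (x 2 * (3 * x 0 ^ 2 + (x 1 ^ 2 + x 2 ^ 2)) / (√2 * ‖x‖ ^ 3))) x := by
  have h2p : 0 < √2 := by positivity
  have hr : 0 < ‖x‖ := norm_pos_iff.2 hx
  have hs := norm3 x
  have hS : ∀ y : EuclideanSpace ℝ (Fin 3), ‖y‖ = √(y 0 ^ 2 + y 1 ^ 2 + y 2 ^ 2) := by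
    intro y; rw [← norm3, Real.sqrt_sq (norm_nonneg y)]
  have hn := (((proj3 1 x).pow 2).add ((proj3 2 x).pow 2)).sub ((proj3 0 x).pow 2)
  have hd := (((((proj3 0 x).pow 2).add ((proj3 1 x).pow 2)).add ((proj3 2 x).pow 2)).sqrt
    (by simp only [Pi.add_apply, ← hs]; positivity)).const_mul √2
  have := fd_div hn hd (by simp only [Pi.add_apply, ← hS]; positivity)
  refine grad3 (this.congr_of_eventuallyEq (Eventually.of_forall fun y => ?_)) ?_
  · simp [u0, hS]
  · intro v
    simp [← hS]
    field_simp
    simp only [hs]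
    ring

lemma pt_smul (s t : ℝ) : pt s t = s • pt 1 0 + t • pt 0 1 := by
  symm
  apply pt_ext <;> simp [pt_zero, pt_one]

def Gf (a : ℝ) (p : EuclideanSpace ℝ (Fin 3)) : ℝ :=
  Hf a (pt (p 0) (Real.sqrt ((p 1) ^ 2 + (p 2) ^ 2)))

lemma Gf_grad {a m e1 e2 : ℝ} (ha : 0 < a) (he : e1 ^ 2 + e2 ^ 2 = 1) :
    HasGradientAt (Gf a) (pt3 (Qf a m - m * Kf a m) (Kf a m * e1) (Kf a m * e2))
      (pt3 (Xf m) (e1 * Yf m) (e2 * Yf m)) := by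
  set p := pt3 (Xf m) (e1 * Yf m) (e2 * Yf m) with hp
  have hp0 : p 0 = Xf m := pt3_0 _ _ _
  have hp1 : p 1 = e1 * Yf m := pt3_1 _ _ _
  have hp2 : p 2 = e2 * Yf m := pt3_2 _ _ _
  have hY := Yf_pos m
  have hsum : p 1 ^ 2 + p 2 ^ 2 = Yf m ^ 2 := by
    rw [hp1, hp2]; linear_combination Yf m ^ 2 * he
  have hsq : √(p 1 ^ 2 + p 2 ^ 2) = Yf m := by rw [hsum, Real.sqrt_sq hY.le]
  have hs := (((proj3 1 p).pow 2).add ((proj3 2 p).pow 2)).sqrt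
    (by simp only [Pi.add_apply, hsum]; positivity)
  have hmap := ((proj3 0 p).smul_const (pt 1 0)).add (hs.smul_const (pt 0 1))
  have hH := hasGradientAt_iff_hasFDerivAt.1 (Hf_grad1 (m := m) (σ := 1) ha (Or.inl rfl))
  have hpt : pt (Xf m) (1 * Yf m) =
      p 0 • pt 1 0 + √(p 1 ^ 2 + p 2 ^ 2) • pt 0 1 := by
    rw [hsq, hp0, one_mul, ← pt_smul]
  rw [hpt] at hH
  have := HasFDerivAt.comp p hH hmap
  refine grad3 (this.congr_of_eventuallyEq (Eventually.of_forall fun y => ?_)) ?_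
  · simp [Gf, ← pt_smul]
  · intro v
    have hsq' : √((e1 * Yf m) ^ 2 + (e2 * Yf m) ^ 2) = Yf m := by rw [← hp1, ← hp2]; exact hsq
    simp [inner2, pt_zero, pt_one, hp1, hp2, hsq']
    field_simp
    ring

lemma Gf_cont : Continuous (fun p : EuclideanSpace ℝ (Fin 3) =>
    pt (p 0) (√((p 1) ^ 2 + (p 2) ^ 2))) := by
  have : (fun p : EuclideanSpace ℝ (Fin 3) => pt (p 0) (√((p 1) ^ 2 + (p 2) ^ 2))) =
      fun p => p 0 • pt 1 0 + √((p 1) ^ 2 + (p 2) ^ 2) • pt 0 1 := by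
    funext p; exact pt_smul _ _
  rw [this]; fun_prop

lemma Gf_grad_axis_neg {a s : ℝ} (ha : 0 < a) (hs : s < 0) :
    HasGradientAt (Gf a) (pt3 (-Qf a 1) 0 0) (pt3 s 0 0) := by
  have hmem : pt (pt3 s 0 0 0) (√((pt3 s 0 0 1) ^ 2 + (pt3 s 0 0 2) ^ 2)) ∈ D2 a := by
    rw [pt3_0, pt3_1, pt3_2]
    refine ⟨by rwa [pt_zero], ?_⟩
    rw [pt_zero, pt_one]
    norm_num
    have : 0 < (a / 4) ^ 3 * (-s) := mul_pos (by positivity) (by linarith)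
    linarith
  have e : Gf a =ᶠ[nhds (pt3 s 0 0)] fun p => -Qf a 1 * p 0 + -Ef a 1 := by
    filter_upwards [Gf_cont.continuousAt.eventually ((D2_open a).eventually_mem hmem)] with q hq
    have := Hf_D2 ha hq
    rw [pt_zero] at this
    exact this
  refine grad3 ((((proj3 0 _).const_mul (-Qf a 1)).add_const _).congr_of_eventuallyEq e) ?_
  intro v; simp

lemma Gf_grad_axis_pos {a s : ℝ} (ha : 0 < a) (hs : 0 < s) :
    HasGradientAt (Gf a) (pt3 (Qf a 1) 0 0) (pt3 s 0 0) := by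
  have hmem : pt (pt3 s 0 0 0) (√((pt3 s 0 0 1) ^ 2 + (pt3 s 0 0 2) ^ 2)) ∈ D4 a := by
    rw [pt3_0, pt3_1, pt3_2]
    refine ⟨by rwa [pt_zero], ?_⟩
    rw [pt_zero, pt_one]
    norm_num
    have : 0 < (a / 4) ^ 3 * s := mul_pos (by positivity) (by linarith)
    linarith
  have e : Gf a =ᶠ[nhds (pt3 s 0 0)] fun p => Qf a 1 * p 0 + -Ef a 1 := by
    filter_upwards [Gf_cont.continuousAt.eventually ((D4_open a).eventually_mem hmem)] with q hq
    have := Hf_D4 ha hq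
    rw [pt_zero] at this
    exact this
  refine grad3 ((((proj3 0 _).const_mul (Qf a 1)).add_const _).congr_of_eventuallyEq e) ?_
  intro v; simp

def rho (x : EuclideanSpace ℝ (Fin 3)) : ℝ := √(x 1 ^ 2 + x 2 ^ 2)
def mm (x : EuclideanSpace ℝ (Fin 3)) : ℝ := -(x 0) / rho x

open Classical in
def V0 (a : ℝ) (x : EuclideanSpace ℝ (Fin 3)) : ℝ :=
  if rho x = 0 then (if 0 < x 0 then -Qf a 1 else Qf a 1) else Qf a (mm x) - mm x * Kf a (mm x)
def V1 (a : ℝ) (x : EuclideanSpace ℝ (Fin 3)) : ℝ := Kf a (mm x) * (x 1 / rho x)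
def V2 (a : ℝ) (x : EuclideanSpace ℝ (Fin 3)) : ℝ := Kf a (mm x) * (x 2 / rho x)

lemma rho_nonneg (x : EuclideanSpace ℝ (Fin 3)) : 0 ≤ rho x := Real.sqrt_nonneg _
lemma rho_sq (x : EuclideanSpace ℝ (Fin 3)) : rho x ^ 2 = x 1 ^ 2 + x 2 ^ 2 :=
  Real.sq_sqrt (by positivity)

lemma V_grad {a : ℝ} (ha : 0 < a) {x : EuclideanSpace ℝ (Fin 3)} (hx : x ≠ 0) :
    gradient (Gf a) (gradient u0 x) = pt3 (V0 a x) (V1 a x) (V2 a x) := by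
  have hr : 0 < ‖x‖ := norm_pos_iff.2 hx
  have hs := norm3 x
  have hρ := rho_sq x
  have h2p : 0 < √2 := by positivity
  rw [(u0_grad hx).gradient]
  by_cases h : rho x = 0
  · rw [h] at hρ
    have h1 : x 1 = 0 := by nlinarith [sq_nonneg (x 1), sq_nonneg (x 2)]
    have h2 : x 2 = 0 := by nlinarith [sq_nonneg (x 1), sq_nonneg (x 2)]
    have h0 : x 0 ≠ 0 := by
      intro h0
      rw [h0, h1, h2] at hs
      nlinarith
    have e1 : V1 a x = 0 := by simp [V1, h]
    have e2 : V2 a x = 0 := by simp [V2, h]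
    rw [e1, e2, h1, h2]
    simp only [zero_mul, zero_div]
    unfold V0
    rw [if_pos h]
    split_ifs with hp
    · refine (Gf_grad_axis_neg ha ?_).gradient
      apply div_neg_of_neg_of_pos _ (by positivity)
      have : 0 < x 0 * (x 0 ^ 2 + 3 * (0 ^ 2 + 0 ^ 2)) := by positivity
      linarith
    · have hn : x 0 < 0 := lt_of_le_of_ne (not_lt.1 hp) h0
      refine (Gf_grad_axis_pos ha ?_).gradient
      have : 0 < -x 0 := by linarith
      positivity
  · have hρp : 0 < rho x := lt_of_le_of_ne (rho_nonneg x) (Ne.symm h)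
    have hsc : ‖x‖ ^ 2 = rho x ^ 2 * (1 + mm x ^ 2) := by
      unfold mm; field_simp; rw [hs, hρ]; ring
    have hmm : mm x * rho x = -x 0 := by unfold mm; field_simp
    have hX := X_scale hρp hr hsc
    have hY := Y_scale hρp hr hsc
    rw [hmm] at hX hY
    have he : (x 1 / rho x) ^ 2 + (x 2 / rho x) ^ 2 = 1 := by
      field_simp; rw [hρ]
    have := (Gf_grad (a := a) (m := mm x) ha he).gradient
    unfold V0 V1 V2
    rw [if_neg h, ← this]
    congr 1
    rw [hX, hY, ← hρ]
    congr 1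
    · ring
    · field_simp; ring
    · field_simp; ring

lemma V_cone_pos {a : ℝ} (ha : 0 < a) {x : EuclideanSpace ℝ (Fin 3)} (hx : rho x < x 0) :
    V0 a x = -Qf a 1 ∧ V1 a x = 0 ∧ V2 a x = 0 := by
  have h0 := rho_nonneg x
  by_cases h : rho x = 0
  · refine ⟨?_, by simp [V1, h], by simp [V2, h]⟩
    unfold V0
    rw [if_pos h, if_pos (by linarith)]
  · have hρp : 0 < rho x := lt_of_le_of_ne (rho_nonneg x) (Ne.symm h)
    have h1 : 1 ≤ -mm x := by
      unfold mm; rw [← neg_div, neg_neg, le_div_iff₀ hρp]; linarith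
    have hz : 1 - (-mm x) ^ 2 ≤ a := by nlinarith
    have e1 := Kf_zero ha hz
    have e2 := Qf_const ha (by linarith) hz
    rw [Kf_neg] at e1
    rw [Qf_neg] at e2
    unfold V0 V1 V2
    rw [if_neg h, e1]
    exact ⟨by linarith, by ring, by ring⟩

lemma V_cone_neg {a : ℝ} (ha : 0 < a) {x : EuclideanSpace ℝ (Fin 3)} (hx : rho x < -x 0) :
    V0 a x = Qf a 1 ∧ V1 a x = 0 ∧ V2 a x = 0 := by
  have h0 := rho_nonneg x
  by_cases h : rho x = 0
  · refine ⟨?_, by simp [V1, h], by simp [V2, h]⟩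
    unfold V0
    rw [if_pos h, if_neg (by linarith)]
  · have hρp : 0 < rho x := lt_of_le_of_ne (rho_nonneg x) (Ne.symm h)
    have h1 : 1 ≤ mm x := by
      unfold mm; rw [le_div_iff₀ hρp]; linarith
    have hz : 1 - (mm x) ^ 2 ≤ a := by nlinarith
    have e1 := Kf_zero ha hz
    have e2 := Qf_const ha (by linarith) hz
    unfold V0 V1 V2
    rw [if_neg h, e1]
    exact ⟨by linarith, by ring, by ring⟩

lemma rho_cont : Continuous rho := by unfold rho; fun_prop

/-- In the cone region all components are locally constant. -/
lemma V_cone {a : ℝ} (ha : 0 < a) {x : EuclideanSpace ℝ (Fin 3)} (hx : x ≠ 0) (h : rho x = 0) :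
    ∃ c : ℝ, V0 a =ᶠ[nhds x] (fun _ => c) ∧ V1 a =ᶠ[nhds x] (fun _ => 0) ∧
      V2 a =ᶠ[nhds x] (fun _ => 0) := by
  have hs := norm3 x
  have hr : 0 < ‖x‖ := norm_pos_iff.2 hx
  have hρ := rho_sq x
  have h0 : x 0 ≠ 0 := by
    intro h0
    rw [h0] at hs
    rw [h] at hρ
    nlinarith
  rcases lt_or_gt_of_ne h0 with hn | hp
  · have ho : IsOpen {x : EuclideanSpace ℝ (Fin 3) | rho x < -x 0} :=
      isOpen_lt rho_cont (by fun_prop)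
    have hev := ho.eventually_mem (show rho x < -x 0 by linarith)
    exact ⟨Qf a 1, hev.mono fun y hy => (V_cone_neg ha hy).1,
      hev.mono fun y hy => (V_cone_neg ha hy).2.1, hev.mono fun y hy => (V_cone_neg ha hy).2.2⟩
  · have ho : IsOpen {x : EuclideanSpace ℝ (Fin 3) | rho x < x 0} :=
      isOpen_lt rho_cont (by fun_prop)
    have hev := ho.eventually_mem (show rho x < x 0 by linarith)
    exact ⟨-Qf a 1, hev.mono fun y hy => (V_cone_pos ha hy).1,
      hev.mono fun y hy => (V_cone_pos ha hy).2.1, hev.mono fun y hy => (V_cone_pos ha hy).2.2⟩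

lemma V0_ev (a : ℝ) {x : EuclideanSpace ℝ (Fin 3)} (h : rho x ≠ 0) :
    V0 a =ᶠ[nhds x] fun x => Qf a (mm x) - mm x * Kf a (mm x) := by
  have ho : IsOpen {x : EuclideanSpace ℝ (Fin 3) | rho x ≠ 0} :=
    isOpen_ne_fun rho_cont continuous_const
  exact (ho.eventually_mem h).mono fun y hy => if_neg hy

lemma V_contDiffAt {a : ℝ} (ha : 0 < a) {x : EuclideanSpace ℝ (Fin 3)} (hx : x ≠ 0) :
    ContDiffAt ℝ 1 (V0 a) x ∧ ContDiffAt ℝ 1 (V1 a) x ∧ ContDiffAt ℝ 1 (V2 a) x := by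
  by_cases h : rho x = 0
  · obtain ⟨c, e0, e1, e2⟩ := V_cone ha hx h
    exact ⟨contDiffAt_const.congr_of_eventuallyEq e0, contDiffAt_const.congr_of_eventuallyEq e1,
      contDiffAt_const.congr_of_eventuallyEq e2⟩
  · have hp : ∀ i : Fin 3, ContDiffAt ℝ 1 (fun p : EuclideanSpace ℝ (Fin 3) => p i) x := by
      intro i; fun_prop
    have hρ : ContDiffAt ℝ 1 rho x := by
      refine ((((hp 1).pow 2).add ((hp 2).pow 2))).sqrt ?_
      have := rho_sq x
      rw [← this]
      exact pow_ne_zero 2 h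
    have hm : ContDiffAt ℝ 1 mm x := (hp 0).neg.div hρ h
    have hK := ((Kf_contDiff a).of_le (by exact_mod_cast le_top) : ContDiff ℝ 1 (Kf a)).contDiffAt.comp x hm
    have hQ := ((Qf_contDiff a).of_le (by exact_mod_cast le_top) : ContDiff ℝ 1 (Qf a)).contDiffAt.comp x hm
    exact ⟨(hQ.sub (hm.mul hK)).congr_of_eventuallyEq (V0_ev a h), hK.mul ((hp 1).div hρ h),
      hK.mul ((hp 2).div hρ h)⟩

lemma V_div {a : ℝ} (ha : 0 < a) {x : EuclideanSpace ℝ (Fin 3)} (hx : x ≠ 0) :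
    fderiv ℝ (V0 a) x (EuclideanSpace.single 0 1) + fderiv ℝ (V1 a) x (EuclideanSpace.single 1 1) +
      fderiv ℝ (V2 a) x (EuclideanSpace.single 2 1) = 0 := by
  by_cases h : rho x = 0
  · obtain ⟨c, e0, e1, e2⟩ := V_cone ha hx h
    rw [e0.fderiv_eq, e1.fderiv_eq, e2.fderiv_eq]
    simp
  · have hρs := rho_sq x
    have hρp : 0 < rho x := lt_of_le_of_ne (rho_nonneg x) (Ne.symm h)
    have hρ0 := (((proj3 1 x).pow 2).add ((proj3 2 x).pow 2)).sqrt
      (by simp only [Pi.add_apply]; rw [← hρs]; positivity)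
    have hρ : HasFDerivAt rho ((x 1 / rho x) • (EuclideanSpace.proj (𝕜 := ℝ) (1 : Fin 3) :
        EuclideanSpace ℝ (Fin 3) →L[ℝ] ℝ) + (x 2 / rho x) • (EuclideanSpace.proj (𝕜 := ℝ)
        (2 : Fin 3) : EuclideanSpace ℝ (Fin 3) →L[ℝ] ℝ)) x := by
      refine hρ0.congr_fderiv ?_
      ext v
      simp [← show rho x = √(x 1 ^ 2 + x 2 ^ 2) from rfl]
      field_simp
    have hm : HasFDerivAt mm _ x := fd_div (proj3 0 x).neg hρ h
    have hK := (Kf_deriv a (mm x)).comp_hasFDerivAt x hm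
    have hQ := (Qf_deriv a (mm x)).comp_hasFDerivAt x hm
    have h0 := (hQ.sub (hm.mul hK)).congr_of_eventuallyEq (V0_ev a h)
    have h1 : HasFDerivAt (V1 a) _ x := hK.mul (fd_div (proj3 1 x) hρ h)
    have h2 : HasFDerivAt (V2 a) _ x := hK.mul (fd_div (proj3 2 x) hρ h)
    rw [h0.fderiv, h1.fderiv, h2.fderiv]
    have hmm : x 0 = -(mm x * rho x) := by unfold mm; field_simp
    simp
    rw [hmm]
    have hx1 : x 1 ^ 2 = rho x ^ 2 - x 2 ^ 2 := by linarith
    field_simp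
    ring_nf
    simp only [hx1]
    ring


/-! ### The weak Euler–Lagrange equation -/

lemma integral_fderiv_zero {f : EuclideanSpace ℝ (Fin 3) → ℝ} (hf : ContDiff ℝ 1 f)
    (hc : HasCompactSupport f) (v : EuclideanSpace ℝ (Fin 3)) :
    Integrable (fun x => fderiv ℝ f x v) ∧ ∫ x, fderiv ℝ f x v = 0 := by
  have hcont : Continuous (fun x => fderiv ℝ f x v) :=
    (hf.continuous_fderiv (by norm_num)).clm_apply continuous_const
  have hi : Integrable (fun x => fderiv ℝ f x v) :=
    hcont.integrable_of_hasCompactSupport (hc.fderiv_apply ℝ v)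
  have hi2 : Integrable f := hf.continuous.integrable_of_hasCompactSupport hc
  refine ⟨hi, ?_⟩
  have := integral_mul_fderiv_eq_neg_fderiv_mul_of_integrable (𝕜 := ℝ) (μ := volume)
    (f := fun _ : EuclideanSpace ℝ (Fin 3) => (1 : ℝ)) (g := f) (v := v)
    (by simp) (by simpa using hi) (by simpa using hi2)
    (fun x _ => by fun_prop) (fun x _ => (hf.differentiable (by norm_num)).differentiableAt)
  simpa using this

lemma mul_test_contDiff {V ψ : EuclideanSpace ℝ (Fin 3) → ℝ}
    (hV : ∀ x, x ≠ 0 → ContDiffAt ℝ 1 V x) (hψ : ContDiff ℝ (⊤ : ℕ∞) ψ)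
    (hs : tsupport ψ ⊆ ball (0 : EuclideanSpace ℝ (Fin 3)) 1 \ {0}) :
    ContDiff ℝ 1 (fun x => V x * ψ x) := by
  rw [contDiff_iff_contDiffAt]
  intro x
  by_cases hx : x ∈ tsupport ψ
  · have hx0 : x ≠ 0 := fun h => (hs hx).2 h
    exact (hV x hx0).mul ((hψ.of_le (by exact_mod_cast le_top)).contDiffAt)
  · have h := notMem_tsupport_iff_eventuallyEq.1 hx
    refine (contDiffAt_const (c := (0 : ℝ))).congr_of_eventuallyEq ?_
    filter_upwards [h] with y hy
    simp [hy]

lemma gradient_apply3 (ψ : EuclideanSpace ℝ (Fin 3) → ℝ) (x : EuclideanSpace ℝ (Fin 3))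
    (i : Fin 3) : gradient ψ x i = fderiv ℝ ψ x (EuclideanSpace.single i 1) := by
  have h : ⟪gradient ψ x, EuclideanSpace.single i 1⟫ =
      fderiv ℝ ψ x (EuclideanSpace.single i 1) := by
    simp [gradient]
  rw [← h, EuclideanSpace.inner_single_right]
  simp

lemma EL {a : ℝ} (ha : 0 < a) (ψ : EuclideanSpace ℝ (Fin 3) → ℝ)
    (hψ : ContDiff ℝ (⊤ : ℕ∞) ψ) (hc : HasCompactSupport ψ)
    (hs : tsupport ψ ⊆ ball (0 : EuclideanSpace ℝ (Fin 3)) 1 \ {0}) :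
    ∫ x in ball (0 : EuclideanSpace ℝ (Fin 3)) 1,
      ⟪gradient (Gf a) (gradient u0 x), gradient ψ x⟫ = 0 := by
  have hgz : ∀ x, x ∉ tsupport ψ → gradient ψ x = 0 := by
    intro x hx
    have h := notMem_tsupport_iff_eventuallyEq.1 hx
    have h' : fderiv ℝ ψ x = 0 := by rw [h.fderiv_eq]; simp
    simp [gradient, h']
  rw [setIntegral_eq_integral_of_forall_compl_eq_zero]
  swap
  · intro x hx
    rw [hgz x (fun h => hx (hs h).1), inner_zero_right]
  have c0 := integral_fderiv_zero
    (mul_test_contDiff (fun x hx => (V_contDiffAt ha hx).1) hψ hs)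
    (hc.mul_left) (EuclideanSpace.single 0 1)
  have c1 := integral_fderiv_zero
    (mul_test_contDiff (fun x hx => (V_contDiffAt ha hx).2.1) hψ hs)
    (hc.mul_left) (EuclideanSpace.single 1 1)
  have c2 := integral_fderiv_zero
    (mul_test_contDiff (fun x hx => (V_contDiffAt ha hx).2.2) hψ hs)
    (hc.mul_left) (EuclideanSpace.single 2 1)
  have key : ∀ x, ⟪gradient (Gf a) (gradient u0 x), gradient ψ x⟫ =
      fderiv ℝ (fun x => V0 a x * ψ x) x (EuclideanSpace.single 0 1) +
      fderiv ℝ (fun x => V1 a x * ψ x) x (EuclideanSpace.single 1 1) +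
      fderiv ℝ (fun x => V2 a x * ψ x) x (EuclideanSpace.single 2 1) := by
    intro x
    by_cases hx : x ∈ tsupport ψ
    · have hx0 : x ≠ 0 := fun h => (hs hx).2 h
      obtain ⟨d0, d1, d2⟩ := V_contDiffAt ha hx0
      have dψ : DifferentiableAt ℝ ψ x := (hψ.differentiable (by simp)).differentiableAt
      have hd := V_div ha hx0
      rw [V_grad ha hx0, inner3, pt3_0, pt3_1, pt3_2, gradient_apply3, gradient_apply3,
        gradient_apply3, fderiv_fun_mul (d0.differentiableAt (by norm_num)) dψ,
        fderiv_fun_mul (d1.differentiableAt (by norm_num)) dψ,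
        fderiv_fun_mul (d2.differentiableAt (by norm_num)) dψ]
      simp only [ContinuousLinearMap.add_apply, ContinuousLinearMap.smul_apply, smul_eq_mul]
      linear_combination (-ψ x) * hd
    · have h := notMem_tsupport_iff_eventuallyEq.1 hx
      have hz : ∀ V : EuclideanSpace ℝ (Fin 3) → ℝ, fderiv ℝ (fun x => V x * ψ x) x = 0 := by
        intro V
        have : (fun x => V x * ψ x) =ᶠ[nhds x] fun _ => (0 : ℝ) := by
          filter_upwards [h] with y hy
          simp [hy]
        rw [this.fderiv_eq]; simp
      rw [hgz x hx, hz, hz, hz]; simp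
  simp_rw [key]
  refine (integral_add (c0.1.add c1.1) c2.1).trans ?_
  have h01 := integral_add c0.1 c1.1
  simp only [Pi.add_apply]
  rw [h01, c0.2, c1.2, c2.2]
  simp

/-- The smoothed construction: there are `δ ∈ (0,1)` and `γ > 0` such that for every `ε > 0`
there is a smooth `H` near `Γ`, linear near `Γ₂` and `Γ₄`, whose associated rotationally
symmetric `G` satisfies the Euler–Lagrange equation weakly in `B₁ ∖ {0}`, with
`H_y ≥ 1/2` on the middle of `Γ₁` and `H_y ≥ 0` on `Γ₁`, quadratic separation `γ|p−q|²`
from middle points of `Γ₁`, and separation at worst `−ε|p−q|²` on `Γ`. -/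
theorem statement12 (φ : ℝ → ℝ)
    (hφc : ContinuousOn φ (Set.Icc (-1) 1))
    (hφgraph : Ga1 = {p : EuclideanSpace ℝ (Fin 2) | p 0 ∈ Set.Icc (-1 : ℝ) 1 ∧ p 1 = φ (p 0)}) :
    ∃ δ ∈ Set.Ioo (0 : ℝ) 1, ∃ γ > (0 : ℝ), ∀ ε > (0 : ℝ),
      ∃ (U : Set (EuclideanSpace ℝ (Fin 2))) (H : EuclideanSpace ℝ (Fin 2) → ℝ),
        IsOpen U ∧ Ga ⊆ U ∧ ContDiffOn ℝ (⊤ : ℕ∞) H U ∧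
        -- (1) linear (in `p₁`) near `Γ₂` and near `Γ₄`
        (∃ m₂ b₂ : ℝ, ∃ V₂ : Set (EuclideanSpace ℝ (Fin 2)), IsOpen V₂ ∧ Ga2 ⊆ V₂ ∧
          ∀ p ∈ V₂, H p = m₂ * p 0 + b₂) ∧
        (∃ m₄ b₄ : ℝ, ∃ V₄ : Set (EuclideanSpace ℝ (Fin 2)), IsOpen V₄ ∧ Ga4 ⊆ V₄ ∧
          ∀ p ∈ V₄, H p = m₄ * p 0 + b₄) ∧
        -- (2) Euler–Lagrange equation weakly in `B₁ ∖ {0}`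
        (∀ ψ : EuclideanSpace ℝ (Fin 3) → ℝ, ContDiff ℝ (⊤ : ℕ∞) ψ → HasCompactSupport ψ →
          tsupport ψ ⊆ ball (0 : EuclideanSpace ℝ (Fin 3)) 1 \ {0} →
          ∫ x in ball (0 : EuclideanSpace ℝ (Fin 3)) 1,
            ⟪gradient (fun p : EuclideanSpace ℝ (Fin 3) =>
                H (pt (p 0) (Real.sqrt ((p 1) ^ 2 + (p 2) ^ 2)))) (gradient u0 x),
              gradient ψ x⟫ = 0) ∧
        -- (3) `H_y(x,φ(x)) ≥ 1/2` for `x ∈ [−1+δ, 1−δ]`, and `H_y ≥ 0` on `Γ₁`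
        (∀ x ∈ Set.Icc (-1 + δ) (1 - δ),
          1 / 2 ≤ fderiv ℝ H (pt x (φ x)) (EuclideanSpace.single 1 1)) ∧
        (∀ p ∈ Ga1, 0 ≤ fderiv ℝ H p (EuclideanSpace.single 1 1)) ∧
        -- (4) quadratic separation from middle points of `Γ₁`
        (∀ x ∈ Set.Icc (-1 + δ) (1 - δ), ∀ q ∈ Ga,
          γ * ‖pt x (φ x) - q‖ ^ 2 ≤
            H q - H (pt x (φ x)) - ⟪gradient H (pt x (φ x)), q - pt x (φ x)⟫) ∧
        -- (5) almost-convexity on all of `Γ`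
        (∀ p ∈ Ga, ∀ q ∈ Ga,
          -ε * ‖p - q‖ ^ 2 ≤ H q - H p - ⟪gradient H p, q - p⟫) := by
  refine ⟨4 / 5, by norm_num, 1 / 4000000, by norm_num, fun ε hε => ?_⟩
  set a : ℝ := min (1 / 200) (ε / 16) with hadef
  have h0 : 0 < a := lt_min (by norm_num) (by positivity)
  have ha : a ≤ 1 / 200 := min_le_left _ _
  have hae : 16 * a ≤ ε := by
    have : a ≤ ε / 16 := min_le_right _ _
    linarith
  have hmid : ∀ x ∈ Set.Icc (-1 + 4 / 5 : ℝ) (1 - 4 / 5),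
      pt x (φ x) ∈ Ga ∧ ∃ m, |m| ≤ 1 / 4 ∧ pt x (φ x) = pt (Xf m) (Yf m) := by
    intro x hx
    have h1 := hx.1
    have h2 := hx.2
    have hmem : pt x (φ x) ∈ Ga1 := by
      rw [hφgraph]
      refine ⟨?_, ?_⟩
      · rw [pt_zero]; constructor <;> linarith
      · rw [pt_zero, pt_one]
    refine ⟨hmem.1, mid_param hmem ?_⟩
    rw [pt_zero, abs_le]; constructor <;> linarith
  refine ⟨D1 ∪ D2 a ∪ D4 a, Hf a, (D1_open.union (D2_open a)).union (D4_open a), Ga_sub h0,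
    Hf_contDiffOn h0, ⟨-Qf a 1, -Ef a 1, D2 a, D2_open a, Ga2_sub h0, fun p hp => Hf_D2 h0 hp⟩,
    ⟨Qf a 1, -Ef a 1, D4 a, D4_open a, Ga4_sub h0, fun p hp => Hf_D4 h0 hp⟩,
    fun ψ hψ hc hs => EL h0 ψ hψ hc hs, ?_, fun p hp => H_y_nonneg h0 hp, ?_,
    fun p hp q hq => sep5 h0 ha hae hp hq⟩
  · intro x hx
    obtain ⟨_, m, hm, e⟩ := hmid x hx
    rw [e]; exact H_y_mid h0 ha hm
  · intro x hx q hq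
    obtain ⟨hg, m, hm, e⟩ := hmid x hx
    rw [e] at hg ⊢
    exact sep4 h0 ha hm hg hq
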